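/- arXiv:math/0406344 — 2 statements merged into one kernel-verified Lean document; each statement's English description precedes it below -/
import Mathlib

section
/- Let ω be a strictly positive C^∞-smooth weight on the closed unit disk D̄ such that the function z ↦ log(ω(z)/(1−|z|²)) is subharmonic on D. Suppose K : D̄ × D → ℂ is such that for every w ∈ D the function K(·,w) is holomorphic on D, extends continuously to D̄, belongs to A²(D,ω), and reproduces at w for the weight ω. Then K(z,w) ≠ 0 for all (z,w) ∈ D × D. -/
open Complex MeasureTheory Metric Set

noncomputable section

/-- The open unit disk in ℂ. -/
def unitDisk : Set ℂ := Metric.ball 0 1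

/-- The closed unit disk in ℂ. -/
def closedDisk : Set ℂ := Metric.closedBall 0 1

/-- The unit circle in ℂ. -/
def unitCircle : Set ℂ := Metric.sphere 0 1

/-- The normalized area measure dΣ = dx dy / π on ℂ. -/
def dSigma : Measure ℂ := (ENNReal.ofReal (1 / Real.pi)) • (volume : Measure ℂ)

/-- The normalized Laplacian Δ = (1/4)(∂²ₓ + ∂²_y) of a real-valued function on ℂ. -/
def lapR (u : ℂ → ℝ) (z : ℂ) : ℝ :=
  (1/4) * (fderiv ℝ (fun w => fderiv ℝ u w 1) z 1
    + fderiv ℝ (fun w => fderiv ℝ u w Complex.I) z Complex.I)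

/-- The normalized Laplacian Δ = (1/4)(∂²ₓ + ∂²_y) of a complex-valued function on ℂ. -/
def lapC (u : ℂ → ℂ) (z : ℂ) : ℂ :=
  (1/4) * (fderiv ℝ (fun w => fderiv ℝ u w 1) z 1
    + fderiv ℝ (fun w => fderiv ℝ u w Complex.I) z Complex.I)

/-- Membership in the weighted Bergman space A²(𝔻, ω): holomorphic on the unit disk
and square integrable against the weight ω with respect to dΣ. -/
def MemA2 (ω : ℂ → ℝ) (f : ℂ → ℂ) : Prop :=
  DifferentiableOn ℂ f unitDisk ∧
    IntegrableOn (fun z => ‖f z‖ ^ 2 * ω z) unitDisk dSigma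

/-- `k` reproduces at `w` for the weight `ω`. -/
def Reproduces (ω : ℂ → ℝ) (k : ℂ → ℂ) (w : ℂ) : Prop :=
  MemA2 ω k ∧ ∀ f : ℂ → ℂ, MemA2 ω f →
    ∫ z in unitDisk, f z * (starRingEnd ℂ) (k z) * (ω z : ℂ) ∂dSigma = f w

/-- A bounded (complex-valued) harmonic function on the unit disk. -/
def BoundedHarmonicC (h : ℂ → ℂ) : Prop :=
  ContDiffOn ℝ 2 h unitDisk ∧ (∀ z ∈ unitDisk, lapC h z = 0) ∧
    ∃ M : ℝ, ∀ z ∈ unitDisk, ‖h z‖ ≤ M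

/-- A bounded real-valued harmonic function on the unit disk. -/
def BoundedHarmonicR (h : ℂ → ℝ) : Prop :=
  ContDiffOn ℝ 2 h unitDisk ∧ (∀ z ∈ unitDisk, lapR h z = 0) ∧
    ∃ M : ℝ, ∀ z ∈ unitDisk, |h z| ≤ M

/-- The real-linear map `h ↦ α h + β conj h`. -/
def WL (α β : ℂ) : ℂ →L[ℝ] ℂ :=
  α • (ContinuousLinearMap.id ℝ ℂ) + β • (conjCLE : ℂ →L[ℝ] ℂ)

lemma WL_apply (α β h : ℂ) : WL α β h = α * h + β * (starRingEnd ℂ) h := by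
  simp [WL]

/-- `f` has Wirtinger derivatives `α = ∂f`, `β = ∂̄f` at `z`. -/
def HasW (f : ℂ → ℂ) (α β : ℂ) (z : ℂ) : Prop := HasFDerivAt (𝕜 := ℝ) f (WL α β) z

def wd (f : ℂ → ℂ) (z : ℂ) : ℂ := (fderiv ℝ f z 1 - I * fderiv ℝ f z I) / 2
def wdb (f : ℂ → ℂ) (z : ℂ) : ℂ := (fderiv ℝ f z 1 + I * fderiv ℝ f z I) / 2

lemma WL_of (D : ℂ →L[ℝ] ℂ) : WL ((D 1 - I * D I) / 2) ((D 1 + I * D I) / 2) = D := by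
  refine ContinuousLinearMap.ext fun h => ?_
  rw [WL_apply]
  have h1 : D h = h.re * D 1 + h.im * D I := by
    have : h = h.re • (1 : ℂ) + h.im • I := by
      apply Complex.ext <;> simp
    conv_lhs => rw [this]
    rw [map_add, map_smul, map_smul]; simp
  have h2 : (starRingEnd ℂ) h = h.re - h.im * I := by
    apply Complex.ext <;> simp
  have h3 : h = h.re + h.im * I := (re_add_im h).symm
  rw [h1, h2]
  generalize hx : (h.re : ℂ) = x at *
  generalize hy : (h.im : ℂ) = y at *
  rw [h3]
  linear_combination (-(y * D I)) * I_sq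

lemma HasW.wd_eq {f : ℂ → ℂ} {α β z : ℂ} (h : HasW f α β z) : wd f z = α := by
  unfold wd; rw [HasFDerivAt.fderiv h, WL_apply, WL_apply]; simp; ring_nf; simp; ring

lemma HasW.wdb_eq {f : ℂ → ℂ} {α β z : ℂ} (h : HasW f α β z) : wdb f z = β := by
  unfold wdb; rw [HasFDerivAt.fderiv h, WL_apply, WL_apply]; simp; ring_nf; simp; ring

lemma hasW_of_diff {f : ℂ → ℂ} {z : ℂ} (h : DifferentiableAt ℝ f z) :
    HasW f (wd f z) (wdb f z) z := by
  unfold HasW wd wdb; rw [WL_of]; exact h.hasFDerivAt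

lemma HasW.congr {f g : ℂ → ℂ} {α β z : ℂ} (h : HasW f α β z) (hg : g =ᶠ[nhds z] f) :
    HasW g α β z := HasFDerivAt.congr_of_eventuallyEq h hg

lemma HasW.eq' {f : ℂ → ℂ} {α β α' β' z : ℂ} (h : HasW f α β z) (ha : α = α') (hb : β = β') :
    HasW f α' β' z := by subst ha hb; exact h

lemma HasW.of_deriv {f : ℂ → ℂ} {f' z : ℂ} (h : HasDerivAt f f' z) : HasW f f' 0 z := by
  have := h.hasFDerivAt.restrictScalars ℝ
  refine HasFDerivAt.congr_fderiv this (ContinuousLinearMap.ext fun h => ?_)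
  simp [WL_apply]
  try ring

lemma HasW.conj {f : ℂ → ℂ} {α β z : ℂ} (h : HasW f α β z) :
    HasW (fun z => (starRingEnd ℂ) (f z)) ((starRingEnd ℂ) β) ((starRingEnd ℂ) α) z := by
  have := (conjCLE : ℂ →L[ℝ] ℂ).hasFDerivAt.comp z h
  refine HasFDerivAt.congr_fderiv this (ContinuousLinearMap.ext fun h => ?_)
  simp [WL_apply]
  try ring

lemma HasW.add {f g : ℂ → ℂ} {α β α' β' z : ℂ} (hf : HasW f α β z) (hg : HasW g α' β' z) :
    HasW (fun z => f z + g z) (α + α') (β + β') z := by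
  have := HasFDerivAt.add hf hg
  refine HasFDerivAt.congr_fderiv this (ContinuousLinearMap.ext fun h => ?_)
  simp [WL_apply]
  try ring

lemma HasW.sub {f g : ℂ → ℂ} {α β α' β' z : ℂ} (hf : HasW f α β z) (hg : HasW g α' β' z) :
    HasW (fun z => f z - g z) (α - α') (β - β') z := by
  have := HasFDerivAt.sub hf hg
  refine HasFDerivAt.congr_fderiv this (ContinuousLinearMap.ext fun h => ?_)
  simp [WL_apply]
  try ring

lemma HasW.mul {f g : ℂ → ℂ} {α β α' β' z : ℂ} (hf : HasW f α β z) (hg : HasW g α' β' z) :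
    HasW (fun z => f z * g z) (α * g z + f z * α') (β * g z + f z * β') z := by
  have := HasFDerivAt.mul hf hg
  refine HasFDerivAt.congr_fderiv this (ContinuousLinearMap.ext fun h => ?_)
  simp [WL_apply]
  try ring

lemma HasW.comp_hol {f g : ℂ → ℂ} {α β g' z : ℂ} (hg : HasDerivAt g g' (f z))
    (hf : HasW f α β z) : HasW (fun z => g (f z)) (g' * α) (g' * β) z := by
  have := HasFDerivAt.comp z (hg.hasFDerivAt.restrictScalars ℝ) hf
  refine HasFDerivAt.congr_fderiv this (ContinuousLinearMap.ext fun h => ?_)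
  simp [WL_apply]
  try ring

lemma HasW.comp_inner {f φ : ℂ → ℂ} {α β φ' z : ℂ} (hf : HasW f α β (φ z))
    (hφ : HasDerivAt φ φ' z) :
    HasW (fun z => f (φ z)) (α * φ') (β * (starRingEnd ℂ) φ') z := by
  have := HasFDerivAt.comp z hf (hφ.hasFDerivAt.restrictScalars ℝ)
  refine HasFDerivAt.congr_fderiv this (ContinuousLinearMap.ext fun h => ?_)
  simp [WL_apply]
  try ring

lemma HasW.const (c z : ℂ) : HasW (fun _ => c) 0 0 z := HasW.of_deriv (hasDerivAt_const z c)
lemma HasW.id (z : ℂ) : HasW (fun z => z) 1 0 z := HasW.of_deriv (hasDerivAt_id z)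
lemma HasW.cj (z : ℂ) : HasW (fun z => (starRingEnd ℂ) z) 0 1 z := by
  simpa using (HasW.id z).conj
lemma HasW.pow {f : ℂ → ℂ} {α β z : ℂ} (hf : HasW f α β z) (n : ℕ) :
    HasW (fun z => f z ^ n) (n * f z ^ (n-1) * α) (n * f z ^ (n-1) * β) z :=
  HasW.comp_hol (g := fun x => x ^ n) (by simpa using hasDerivAt_pow n (f z)) hf
lemma HasW.inv {f : ℂ → ℂ} {α β z : ℂ} (hf : HasW f α β z) (h0 : f z ≠ 0) :
    HasW (fun z => (f z)⁻¹) (-(f z ^ 2)⁻¹ * α) (-(f z ^ 2)⁻¹ * β) z :=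
  HasW.comp_hol (g := fun x => x⁻¹) (hasDerivAt_inv h0) hf

lemma contDiffOn_fderiv_apply {f : ℂ → ℂ} {U : Set ℂ} (hU : IsOpen U) {n m : ℕ∞}
    (hf : ContDiffOn ℝ n f U) (hmn : m + 1 ≤ n) (v : ℂ) :
    ContDiffOn ℝ m (fun z => fderiv ℝ f z v) U :=
  (hf.fderiv_of_isOpen hU (by exact_mod_cast hmn)).clm_apply contDiffOn_const

lemma contDiffOn_wd {f : ℂ → ℂ} {U : Set ℂ} (hU : IsOpen U) {n m : ℕ∞}
    (hf : ContDiffOn ℝ n f U) (hmn : m + 1 ≤ n) :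
    ContDiffOn ℝ m (wd f) U := by
  unfold wd
  exact ((contDiffOn_fderiv_apply hU hf hmn 1).sub
    (contDiffOn_const.mul (contDiffOn_fderiv_apply hU hf hmn I))).div_const 2

lemma contDiffOn_wdb {f : ℂ → ℂ} {U : Set ℂ} (hU : IsOpen U) {n m : ℕ∞}
    (hf : ContDiffOn ℝ n f U) (hmn : m + 1 ≤ n) :
    ContDiffOn ℝ m (wdb f) U := by
  unfold wdb
  exact ((contDiffOn_fderiv_apply hU hf hmn 1).add
    (contDiffOn_const.mul (contDiffOn_fderiv_apply hU hf hmn I))).div_const 2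

lemma int_zero {G α β : ℂ → ℂ} (h : ∀ z, HasW G (α z) (β z) z) (hG : Integrable G)
    (hα : Integrable α) (hβ : Integrable β) : ∫ z, α z = 0 ∧ ∫ z, β z = 0 := by
  have key : ∀ v : ℂ, ∫ z, (α z * v + β z * (starRingEnd ℂ) v) = 0 := by
    intro v
    have hI : Integrable (fun z => α z * v + β z * (starRingEnd ℂ) v) :=
      (hα.mul_const v).add (hβ.mul_const _)
    have := integral_bilinear_hasLineDerivAt_right_eq_neg_left_of_integrable
      (μ := (volume : Measure ℂ)) (B := ContinuousLinearMap.mul ℝ ℂ) (f := fun _ => (1:ℂ))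
      (f' := fun _ => 0) (g := G) (g' := fun z => α z * v + β z * (starRingEnd ℂ) v) (v := v)
      (by simp) (by simpa using hI) (by simpa using hG)
      (fun z _ => by
        have := (hasFDerivAt_const (𝕜 := ℝ) (1:ℂ) z).hasLineDerivAt v
        simpa using this)
      (fun z _ => by
        have := HasFDerivAt.hasLineDerivAt (h z) v
        rwa [WL_apply] at this)
    simpa using this
  have k1 := key 1
  have k2 := key I
  simp only [map_one, mul_one, conj_I] at k1 k2
  rw [integral_add hα hβ] at k1
  rw [integral_add (hα.mul_const _) (hβ.mul_const _), integral_mul_const, integral_mul_const] at k2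
  have k3 : (∫ z, α z) - ∫ z, β z = 0 := by
    have : I * ((∫ z, α z) - ∫ z, β z) = 0 := by linear_combination k2
    exact (mul_eq_zero.mp this).resolve_left I_ne_zero
  constructor
  · linear_combination (k1 + k3) / 2
  · linear_combination (k1 - k3) / 2

lemma hasW_ext {g α β : ℂ → ℂ} {C : ℝ} (h : ∀ z ∈ ball (0:ℂ) 1, HasW g (α z) (β z) z)
    (hb : ∀ z ∈ ball (0:ℂ) 1, ‖g z‖ ≤ C * (1 - ‖z‖) ^ 2) (z : ℂ) :
    HasW ((ball (0:ℂ) 1).indicator g) ((ball (0:ℂ) 1).indicator α z)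
      ((ball (0:ℂ) 1).indicator β z) z := by
  by_cases hz : z ∈ ball (0:ℂ) 1
  · rw [indicator_of_mem hz, indicator_of_mem hz]
    apply (h z hz).congr
    filter_upwards [isOpen_ball.mem_nhds hz] with x hx
    rw [indicator_of_mem hx]
  · rw [indicator_of_notMem hz, indicator_of_notMem hz]
    have hz1 : 1 ≤ ‖z‖ := by simpa using hz
    have hC : 0 ≤ C := by
      have := hb 0 (by simp)
      simp at this
      exact (norm_nonneg _).trans this
    have e0 : WL 0 0 = 0 := by ext h; simp [WL_apply]
    unfold HasW
    rw [e0]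
    have hO : ∀ x, ‖(ball (0:ℂ) 1).indicator g x‖ ≤ C * ‖x - z‖ ^ 2 := by
      intro x
      by_cases hx : x ∈ ball (0:ℂ) 1
      · rw [indicator_of_mem hx]
        refine (hb x hx).trans ?_
        have hx1 : ‖x‖ < 1 := by simpa using hx
        have : 1 - ‖x‖ ≤ ‖x - z‖ := by
          have := norm_sub_norm_le z x
          rw [norm_sub_rev] at this; linarith
        gcongr
      · rw [indicator_of_notMem hx]; simp; positivity
    have hO' : (ball (0:ℂ) 1).indicator g =O[nhds z] fun x => ‖x - z‖ ^ 2 :=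
      Asymptotics.IsBigO.of_bound C (Filter.Eventually.of_forall fun x => by
        simpa using hO x)
    exact hO'.hasFDerivAt (by norm_num)

lemma stokes {g α β : ℂ → ℂ} {C : ℝ} (h : ∀ z ∈ ball (0:ℂ) 1, HasW g (α z) (β z) z)
    (hb : ∀ z ∈ ball (0:ℂ) 1, ‖g z‖ ≤ C * (1 - ‖z‖) ^ 2)
    (hg : ContinuousOn g (closedBall 0 1)) (hα : ContinuousOn α (closedBall 0 1))
    (hβ : ContinuousOn β (closedBall 0 1)) :
    ∫ z in ball (0:ℂ) 1, α z = 0 ∧ ∫ z in ball (0:ℂ) 1, β z = 0 := by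
  have key : ∀ f : ℂ → ℂ, ContinuousOn f (closedBall 0 1) →
      Integrable ((ball (0:ℂ) 1).indicator f) := fun f hf =>
    (integrable_indicator_iff measurableSet_ball).mpr
      ((hf.integrableOn_compact (isCompact_closedBall 0 1)).mono_set ball_subset_closedBall)
  have := int_zero (hasW_ext h hb) (key g hg) (key α hα) (key β hβ)
  rwa [integral_indicator measurableSet_ball, integral_indicator measurableSet_ball] at this

lemma bdd_of_cont {g : ℂ → ℂ} (hg : ContinuousOn g (closedBall 0 1)) :
    ∃ C : ℝ, 0 ≤ C ∧ ∀ z ∈ closedBall (0:ℂ) 1, ‖g z‖ ≤ C := by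
  obtain ⟨C, hC⟩ := (isCompact_closedBall (0:ℂ) 1).exists_bound_of_continuousOn hg
  exact ⟨C, (norm_nonneg _).trans (hC 0 (by simp)), hC⟩

lemma contOn_int {g : ℂ → ℂ} (hg : ContinuousOn g (closedBall 0 1)) :
    IntegrableOn g (ball (0:ℂ) 1) :=
  (hg.integrableOn_compact (isCompact_closedBall 0 1)).mono_set ball_subset_closedBall

lemma green {e Φ : ℂ → ℂ} {U : Set ℂ} (hU : IsOpen U) (hUs : closedBall (0:ℂ) 1 ⊆ U)
    (he : ContDiffOn ℝ 2 e U) (hΦ : ContDiffOn ℝ 2 Φ U) {C : ℝ}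
    (hb : ∀ z ∈ ball (0:ℂ) 1, ‖Φ z‖ ≤ C * (1 - ‖z‖) ^ 2)
    (hb' : ∀ z ∈ ball (0:ℂ) 1, ‖wd Φ z‖ ≤ C * (1 - ‖z‖) ^ 2) :
    ∫ z in ball (0:ℂ) 1, e z * wdb (wd Φ) z = ∫ z in ball (0:ℂ) 1, Φ z * wd (wdb e) z := by
  have he1 : ContDiffOn ℝ 1 (wdb e) U := contDiffOn_wdb (n := 2) (m := 1) hU he (by norm_num)
  have he0 : ContDiffOn ℝ 1 (wd e) U := contDiffOn_wd (n := 2) (m := 1) hU he (by norm_num)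
  have he2 : ContDiffOn ℝ 0 (wd (wdb e)) U := contDiffOn_wd (n := 1) (m := 0) hU he1 (by norm_num)
  have he3 : ContDiffOn ℝ 0 (wdb (wdb e)) U := contDiffOn_wdb (n := 1) (m := 0) hU he1 (by norm_num)
  have hX : ContDiffOn ℝ 1 (wd Φ) U := contDiffOn_wd (n := 2) (m := 1) hU hΦ (by norm_num)
  have hX' : ContDiffOn ℝ 1 (wdb Φ) U := contDiffOn_wdb (n := 2) (m := 1) hU hΦ (by norm_num)
  have hY : ContDiffOn ℝ 0 (wd (wd Φ)) U := contDiffOn_wd (n := 1) (m := 0) hU hX (by norm_num)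
  have hL : ContDiffOn ℝ 0 (wdb (wd Φ)) U := contDiffOn_wdb (n := 1) (m := 0) hU hX (by norm_num)
  have ce := he.continuousOn.mono hUs
  have ce0 := he0.continuousOn.mono hUs
  have ce1 := he1.continuousOn.mono hUs
  have ce2 := he2.continuousOn.mono hUs
  have ce3 := he3.continuousOn.mono hUs
  have cΦ := hΦ.continuousOn.mono hUs
  have cX := hX.continuousOn.mono hUs
  have cX' := hX'.continuousOn.mono hUs
  have cY := hY.continuousOn.mono hUs
  have cL := hL.continuousOn.mono hUs
  have hC : 0 ≤ C := by
    have := hb 0 (by simp)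
    simp at this
    exact (norm_nonneg _).trans this
  have diff : ∀ {f : ℂ → ℂ} {n : WithTop ℕ∞}, ContDiffOn ℝ n f U → n ≠ 0 → ∀ z ∈ ball (0:ℂ) 1,
      HasW f (wd f z) (wdb f z) z := fun hf hn z hz =>
    hasW_of_diff ((hf.contDiffAt (hU.mem_nhds (hUs (ball_subset_closedBall hz)))).differentiableAt hn)
  obtain ⟨A, hA, hAe⟩ := bdd_of_cont ce
  obtain ⟨B, hB, hBe⟩ := bdd_of_cont ce1
  have s1 := (stokes (g := fun z => e z * wd Φ z) (C := A * C)
    (fun z hz => (diff he (by norm_num) z hz).mul (diff hX (by norm_num) z hz))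
    (fun z hz => by
      rw [norm_mul, mul_assoc]
      exact mul_le_mul (hAe z (ball_subset_closedBall hz)) (hb' z hz) (norm_nonneg _) hA)
    (ce.mul cX) ((ce0.mul cX).add (ce.mul cY)) ((ce1.mul cX).add (ce.mul cL))).2
  have s2 := (stokes (g := fun z => Φ z * wdb e z) (C := C * B)
    (fun z hz => (diff hΦ (by norm_num) z hz).mul (diff he1 (by norm_num) z hz))
    (fun z hz => by
      rw [norm_mul, mul_right_comm]
      exact mul_le_mul (hb z hz) (hBe z (ball_subset_closedBall hz)) (norm_nonneg _) (by positivity))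
    (cΦ.mul ce1) ((cX.mul ce1).add (cΦ.mul ce2)) ((cX'.mul ce1).add (cΦ.mul ce3))).1
  have i1 : IntegrableOn (fun z => wdb e z * wd Φ z) (ball 0 1) := contOn_int (ce1.mul cX)
  have i2 : IntegrableOn (fun z => e z * wdb (wd Φ) z) (ball 0 1) := contOn_int (ce.mul cL)
  have i3 : IntegrableOn (fun z => wd Φ z * wdb e z) (ball 0 1) := contOn_int (cX.mul ce1)
  have i4 : IntegrableOn (fun z => Φ z * wd (wdb e) z) (ball 0 1) := contOn_int (cΦ.mul ce2)
  rw [integral_add i1 i2] at s1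
  rw [integral_add i3 i4] at s2
  have : ∫ z in ball (0:ℂ) 1, wdb e z * wd Φ z = ∫ z in ball (0:ℂ) 1, wd Φ z * wdb e z := by
    congr 1; ext z; ring
  rw [this] at s1
  linear_combination s1 - s2

local notation "cj" => starRingEnd ℂ

def Psi (v ζ : ℂ) : ℂ :=
  v * cj v * (1 - ζ * cj ζ) ^ 3 * (2 * ((1 - cj v * ζ) * (1 - v * cj ζ)) + 2
    - v * cj v * (1 + ζ * cj ζ)) * ((1 - cj v * ζ)⁻¹ ^ 2 * (1 - v * cj ζ)⁻¹ ^ 2)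

def PsiXr (v ζ : ℂ) : ℂ :=
  v * cj v * ((1 - cj v * ζ)⁻¹ ^ 3 * (1 - v * cj ζ)⁻¹ ^ 2) *
   (-3 * cj ζ * (2 * ((1 - cj v * ζ) * (1 - v * cj ζ)) + 2
    - v * cj v * (1 + ζ * cj ζ)) * (1 - cj v * ζ) +
    (1 - ζ * cj ζ) * ((-2 * cj v * (1 - v * cj ζ) - v * cj v * cj ζ) * (1 - cj v * ζ)
      + 2 * cj v * (2 * ((1 - cj v * ζ) * (1 - v * cj ζ)) + 2
    - v * cj v * (1 + ζ * cj ζ))))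

def PsiX (v ζ : ℂ) : ℂ := (1 - ζ * cj ζ) ^ 2 * PsiXr v ζ

def PsiL (v ζ : ℂ) : ℂ :=
  4 * (1 - ζ * cj ζ) * ((1 - v * cj v) ^ 3 * ((1 - cj v * ζ)⁻¹ ^ 3 * (1 - v * cj ζ)⁻¹ ^ 3)
    - (1 - cj v * ζ)⁻¹ ^ 3 - (1 - v * cj ζ)⁻¹ ^ 3 + 1)

lemma conj_p (v ζ : ℂ) : cj (1 - cj v * ζ) = 1 - v * cj ζ := by simp

lemma pc_ne {v ζ : ℂ} (h : 1 - cj v * ζ ≠ 0) : 1 - v * cj ζ ≠ 0 := by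
  rw [← conj_p]; exact (map_ne_zero _).mpr h

lemma hasW_rho (ζ : ℂ) : HasW (fun ζ => 1 - ζ * cj ζ) (-cj ζ) (-ζ) ζ :=
  ((HasW.const 1 ζ).sub ((HasW.id ζ).mul (HasW.cj ζ))).eq' (by simp) (by simp)

lemma hasW_p (v ζ : ℂ) : HasW (fun ζ => 1 - cj v * ζ) (-cj v) 0 ζ :=
  ((HasW.const 1 ζ).sub ((HasW.const (cj v) ζ).mul (HasW.id ζ))).eq' (by simp) (by simp)

lemma hasW_pc (v ζ : ℂ) : HasW (fun ζ => 1 - v * cj ζ) 0 (-v) ζ :=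
  ((HasW.const 1 ζ).sub ((HasW.const v ζ).mul (HasW.cj ζ))).eq' (by simp) (by simp)

lemma hasW_N (v ζ : ℂ) : HasW (fun ζ => 2 * ((1 - cj v * ζ) * (1 - v * cj ζ)) + 2
    - v * cj v * (1 + ζ * cj ζ)) (-2 * cj v * (1 - v * cj ζ) - v * cj v * cj ζ)
      (-2 * v * (1 - cj v * ζ) - v * cj v * ζ) ζ :=
  ((((HasW.const 2 ζ).mul ((hasW_p v ζ).mul (hasW_pc v ζ))).add (HasW.const 2 ζ)).sub
    ((HasW.const (v * cj v) ζ).mul ((HasW.const 1 ζ).add ((HasW.id ζ).mul (HasW.cj ζ))))).eq'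
    (by ring) (by ring)

lemma psi_W1 {v ζ : ℂ} (h : 1 - cj v * ζ ≠ 0) : ∃ β, HasW (Psi v) (PsiX v ζ) β ζ := by
  have h' := pc_ne h
  have := ((((HasW.const (v * cj v) ζ).mul ((hasW_rho ζ).pow 3)).mul (hasW_N v ζ)).mul
    ((((hasW_p v ζ).inv h).pow 2).mul (((hasW_pc v ζ).inv h').pow 2)))
  refine ⟨_, this.eq' ?_ rfl⟩
  unfold PsiX PsiXr
  clear this
  generalize cj ζ = z at *
  generalize cj v = w at *
  generalize hp : 1 - w * ζ = p at *
  generalize hq : 1 - v * z = q at *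
  simp only [Nat.cast_ofNat, Nat.reduceSub]
  field_simp
  subst hp hq
  ring

lemma psi_W2 {v ζ : ℂ} (h : 1 - cj v * ζ ≠ 0) : ∃ α, HasW (PsiX v) α (PsiL v ζ) ζ := by
  have h' := pc_ne h
  have := ((hasW_rho ζ).pow 2).mul
   (((HasW.const (v * cj v) ζ).mul ((((hasW_p v ζ).inv h).pow 3).mul (((hasW_pc v ζ).inv h').pow 2))).mul
    ((((((HasW.const (-3) ζ).mul (HasW.cj ζ)).mul (hasW_N v ζ)).mul (hasW_p v ζ)).add
    ((hasW_rho ζ).mul ((((((HasW.const (-2 * cj v) ζ).mul (hasW_pc v ζ)).sub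
      ((HasW.const (v * cj v) ζ).mul (HasW.cj ζ))).mul (hasW_p v ζ)).add
      ((HasW.const (2 * cj v) ζ).mul (hasW_N v ζ))))))))
  refine ⟨_, this.eq' rfl ?_⟩
  unfold PsiL
  clear this
  generalize cj ζ = z at *
  generalize cj v = w at *
  generalize hp : 1 - w * ζ = p at *
  generalize hq : 1 - v * z = q at *
  simp only [Nat.cast_ofNat, Nat.reduceSub]
  field_simp
  subst hp hq
  ring

lemma contDiff_cj {n : WithTop ℕ∞} : ContDiff ℝ n (fun z : ℂ => cj z) :=
  (conjCLE : ℂ →L[ℝ] ℂ).contDiff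

lemma contDiffOn_psi (v : ℂ) : ContDiffOn ℝ 2 (Psi v) {ζ | 1 - cj v * ζ ≠ 0} := by
  intro ζ hζ
  have h1 : 1 - cj v * ζ ≠ 0 := hζ
  have h2 := pc_ne h1
  have hc : ContDiffAt ℝ 2 (fun z : ℂ => cj z) ζ := contDiff_cj.contDiffAt
  have hi : ContDiffAt ℝ 2 (fun z : ℂ => z) ζ := contDiffAt_id
  have hp : ContDiffAt ℝ 2 (fun ζ : ℂ => 1 - cj v * ζ) ζ :=
    contDiffAt_const.sub (contDiffAt_const.mul hi)
  have hpc : ContDiffAt ℝ 2 (fun ζ : ℂ => 1 - v * cj ζ) ζ :=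
    contDiffAt_const.sub (contDiffAt_const.mul hc)
  apply ContDiffAt.contDiffWithinAt
  unfold Psi
  exact ((contDiffAt_const.mul ((contDiffAt_const.sub (hi.mul hc)).pow 3)).mul
    (((contDiffAt_const.mul (hp.mul hpc)).add contDiffAt_const).sub
      (contDiffAt_const.mul (contDiffAt_const.add (hi.mul hc))))).mul
    (((hp.inv h1).pow 2).mul ((hpc.inv h2).pow 2))

lemma continuousOn_psiXr (v : ℂ) : ContinuousOn (PsiXr v) {ζ | 1 - cj v * ζ ≠ 0} := by
  unfold PsiXr
  have hp : ContinuousOn (fun ζ : ℂ => (1 - cj v * ζ)⁻¹) {ζ | 1 - cj v * ζ ≠ 0} :=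
    ContinuousOn.inv₀ (by fun_prop) (fun x hx => hx)
  have hpc : ContinuousOn (fun ζ : ℂ => (1 - v * cj ζ)⁻¹) {ζ | 1 - cj v * ζ ≠ 0} :=
    ContinuousOn.inv₀ (by fun_prop) (fun x hx => pc_ne hx)
  fun_prop

lemma psi_nonneg {v ζ : ℂ} (hv : ‖v‖ ≤ 1) (hζ : ‖ζ‖ ≤ 1) : ∃ r : ℝ, 0 ≤ r ∧ Psi v ζ = r := by
  refine ⟨‖v‖ ^ 2 * (1 - ‖ζ‖ ^ 2) ^ 3 * (2 * ‖1 - cj v * ζ‖ ^ 2 + 2 - ‖v‖ ^ 2 * (1 + ‖ζ‖ ^ 2))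
    * (‖1 - cj v * ζ‖ ^ 2)⁻¹ ^ 2, ?_, ?_⟩
  · have h1 : ‖v‖ ^ 2 ≤ 1 := by have := norm_nonneg v; nlinarith
    have h2 : ‖ζ‖ ^ 2 ≤ 1 := by have := norm_nonneg ζ; nlinarith
    have h3 : 0 ≤ 2 * ‖1 - cj v * ζ‖ ^ 2 + 2 - ‖v‖ ^ 2 * (1 + ‖ζ‖ ^ 2) := by
      have := sq_nonneg ‖1 - cj v * ζ‖
      have := sq_nonneg ‖v‖
      nlinarith
    have h4 : 0 ≤ (1 - ‖ζ‖ ^ 2) ^ 3 := pow_nonneg (by linarith) 3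
    positivity
  · push_cast
    rw [← mul_conj', ← mul_conj', ← mul_conj', conj_p]
    unfold Psi
    rw [mul_inv, mul_pow]

lemma mob_den {l z : ℂ} (hl : ‖l‖ < 1) (hz : ‖z‖ ≤ 1) : 1 - cj l * z ≠ 0 := by
  intro h
  have h1 : cj l * z = 1 := (sub_eq_zero.mp h).symm
  have : ‖cj l * z‖ = 1 := by rw [h1]; simp
  rw [norm_mul, RCLike.norm_conj] at this
  have := norm_nonneg z
  have := norm_nonneg l
  nlinarith

def mob (l z : ℂ) : ℂ := (z - l) / (1 - cj l * z)
def mob' (l z : ℂ) : ℂ := (1 - l * cj l) / (1 - cj l * z) ^ 2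

lemma hasDerivAt_mob {l z : ℂ} (h : 1 - cj l * z ≠ 0) : HasDerivAt (mob l) (mob' l z) z := by
  have := ((hasDerivAt_id z).sub_const l).div
    (((hasDerivAt_id z).const_mul (cj l)).const_sub 1) h
  refine this.congr_deriv ?_
  unfold mob'
  simp
  field_simp
  ring

lemma mob_rho {l z : ℂ} (h : 1 - cj l * z ≠ 0) : 1 - mob l z * cj (mob l z) =
    (1 - z * cj z) * ((1 - l * cj l) / ((1 - cj l * z) * (1 - l * cj z))) := by
  have h' := pc_ne h
  unfold mob
  simp only [map_div₀, map_sub, map_one, map_mul, conj_conj]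
  generalize cj z = w at *
  generalize cj l = m at *
  generalize hp : 1 - m * z = p at *
  generalize hq : 1 - l * w = q at *
  field_simp
  subst hp hq
  ring

lemma rho_real (z : ℂ) : 1 - z * cj z = ((1 - ‖z‖ ^ 2 : ℝ) : ℂ) := by
  rw [mul_conj']; push_cast; rfl

lemma mob_norm {l z : ℂ} (hl : ‖l‖ < 1) (hz : ‖z‖ < 1) : ‖mob l z‖ < 1 := by
  have h := mob_den hl hz.le
  have h1 := mob_rho h
  rw [rho_real, rho_real, rho_real, ← conj_p, mul_conj'] at h1
  norm_cast at h1
  have : 0 < (1 - ‖z‖ ^ 2) * ((1 - ‖l‖ ^ 2) / ‖1 - cj l * z‖ ^ 2) := by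
    have := norm_pos_iff.mpr h
    have := norm_nonneg z
    have := norm_nonneg l
    have : 0 < 1 - ‖z‖ ^ 2 := by nlinarith
    have : 0 < 1 - ‖l‖ ^ 2 := by nlinarith
    positivity
  rw [← h1] at this
  have := norm_nonneg (mob l z)
  nlinarith

lemma mob_norm_le {l z : ℂ} (hl : ‖l‖ < 1) (hz : ‖z‖ ≤ 1) : ‖mob l z‖ ≤ 1 := by
  have h := mob_den hl hz
  have h1 := mob_rho h
  rw [rho_real, rho_real, rho_real, ← conj_p, mul_conj'] at h1
  norm_cast at h1
  have : 0 ≤ (1 - ‖z‖ ^ 2) * ((1 - ‖l‖ ^ 2) / ‖1 - cj l * z‖ ^ 2) := by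
    have := norm_pos_iff.mpr h
    have := norm_nonneg z
    have := norm_nonneg l
    have : 0 ≤ 1 - ‖z‖ ^ 2 := by nlinarith
    have : 0 < 1 - ‖l‖ ^ 2 := by nlinarith
    positivity
  rw [← h1] at this
  have := norm_nonneg (mob l z)
  nlinarith

/-- The set where all is smooth. -/
def USet (l v : ℂ) : Set ℂ := {z | 1 - cj l * z ≠ 0 ∧ 1 - cj v * mob l z ≠ 0}

lemma mob_contOn (l : ℂ) : ContinuousOn (mob l) {z | 1 - cj l * z ≠ 0} := fun z hz =>
  (hasDerivAt_mob hz).continuousAt.continuousWithinAt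

lemma USet_open (l v : ℂ) : IsOpen (USet l v) := by
  have h1 : IsOpen {z : ℂ | 1 - cj l * z ≠ 0} :=
    isOpen_ne_fun (by fun_prop) continuous_const
  have h2 : IsOpen {z : ℂ | 1 - cj v * z ≠ 0} :=
    isOpen_ne_fun (by fun_prop) continuous_const
  exact (mob_contOn l).isOpen_inter_preimage h1 h2

lemma USet_sub {l v : ℂ} (hl : ‖l‖ < 1) (hv : ‖v‖ < 1) : closedBall (0:ℂ) 1 ⊆ USet l v := by
  intro z hz
  have hz : ‖z‖ ≤ 1 := by simpa using hz
  exact ⟨mob_den hl hz, mob_den hv (mob_norm_le hl hz)⟩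

def Phi (l v z : ℂ) : ℂ := Psi v (mob l z)

lemma contDiffOn_Phi (l v : ℂ) : ContDiffOn ℝ 2 (Phi l v) (USet l v) := by
  have h1 : ContDiffOn ℝ 2 (mob l) (USet l v) := by
    intro z hz
    apply ContDiffAt.contDiffWithinAt
    have hi : ContDiffAt ℝ 2 (fun z : ℂ => z) z := contDiffAt_id
    have hp : ContDiffAt ℝ 2 (fun z : ℂ => 1 - cj l * z) z :=
      contDiffAt_const.sub (contDiffAt_const.mul hi)
    have : mob l = fun z => (z - l) * (1 - cj l * z)⁻¹ := by
      ext z; rw [mob, div_eq_mul_inv]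
    rw [this]
    exact (hi.sub contDiffAt_const).mul (hp.inv hz.1)
  exact (contDiffOn_psi v).comp h1 (fun z hz => hz.2)

lemma wd_Phi {l v z : ℂ} (hz : z ∈ USet l v) : wd (Phi l v) z = PsiX v (mob l z) * mob' l z := by
  obtain ⟨β, hβ⟩ := psi_W1 hz.2
  exact (HasW.comp_inner hβ (hasDerivAt_mob hz.1)).wd_eq

lemma wdb_wd_Phi {l v z : ℂ} (hz : z ∈ USet l v) :
    wdb (wd (Phi l v)) z = PsiL v (mob l z) * (mob' l z * cj (mob' l z)) := by
  obtain ⟨α, hα⟩ := psi_W2 hz.2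
  have hd : DifferentiableAt ℂ (mob' l) z := by
    unfold mob'
    apply DifferentiableAt.div (by fun_prop) (by fun_prop)
    exact pow_ne_zero 2 hz.1
  have h1 := (HasW.comp_inner hα (hasDerivAt_mob hz.1)).mul (HasW.of_deriv hd.hasDerivAt)
  have h2 : wd (Phi l v) =ᶠ[nhds z] fun z => PsiX v (mob l z) * mob' l z := by
    filter_upwards [(USet_open l v).mem_nhds hz] with x hx using wd_Phi hx
  rw [(h1.congr h2).wdb_eq]
  ring

lemma bound_aux {f g : ℂ → ℂ} (hg : ContinuousOn g (closedBall 0 1))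
    (h : ∀ z ∈ ball (0:ℂ) 1, f z = (1 - z * cj z) ^ 2 * g z) :
    ∃ C : ℝ, ∀ z ∈ ball (0:ℂ) 1, ‖f z‖ ≤ C * (1 - ‖z‖) ^ 2 := by
  obtain ⟨A, hA, hAg⟩ := bdd_of_cont hg
  refine ⟨4 * A, fun z hz => ?_⟩
  have hz1 : ‖z‖ < 1 := by simpa using hz
  have := norm_nonneg z
  rw [h z hz, norm_mul, norm_pow, rho_real, norm_real, Real.norm_of_nonneg (by nlinarith)]
  have h1 : (1 - ‖z‖ ^ 2) ^ 2 ≤ 4 * (1 - ‖z‖) ^ 2 := by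
    have : (1 - ‖z‖ ^ 2) ^ 2 = (1 + ‖z‖) ^ 2 * (1 - ‖z‖) ^ 2 := by ring
    rw [this]
    gcongr
    nlinarith
  calc _ ≤ (4 * (1 - ‖z‖) ^ 2) * A :=
        mul_le_mul h1 (hAg z (ball_subset_closedBall hz)) (norm_nonneg _) (by positivity)
    _ = _ := by ring

lemma Phi_bounds {l v : ℂ} (hl : ‖l‖ < 1) (hv : ‖v‖ < 1) :
    ∃ C : ℝ, (∀ z ∈ ball (0:ℂ) 1, ‖Phi l v z‖ ≤ C * (1 - ‖z‖) ^ 2) ∧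
      ∀ z ∈ ball (0:ℂ) 1, ‖wd (Phi l v) z‖ ≤ C * (1 - ‖z‖) ^ 2 := by
  have hs := USet_sub hl hv
  have cm : ContinuousOn (mob l) (closedBall 0 1) := (mob_contOn l).mono fun _ hz => (hs hz).1
  have cd : ContinuousOn (fun z : ℂ => (1 - cj l * z)⁻¹) (closedBall 0 1) :=
    ContinuousOn.inv₀ (by fun_prop) (fun z hz => (hs hz).1)
  have cdc : ContinuousOn (fun z : ℂ => (1 - l * cj z)⁻¹) (closedBall 0 1) :=
    ContinuousOn.inv₀ (by fun_prop) (fun z hz => pc_ne (hs hz).1)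
  have cp : ContinuousOn (fun z : ℂ => (1 - cj v * mob l z)⁻¹) (closedBall 0 1) :=
    ContinuousOn.inv₀ (by fun_prop) (fun z hz => (hs hz).2)
  have cpc : ContinuousOn (fun z : ℂ => (1 - v * cj (mob l z))⁻¹) (closedBall 0 1) :=
    ContinuousOn.inv₀ (by fun_prop) (fun z hz => pc_ne (hs hz).2)
  have cX : ContinuousOn (fun z => PsiXr v (mob l z)) (closedBall 0 1) :=
    (continuousOn_psiXr v).comp cm (fun z hz => (hs hz).2)
  obtain ⟨A, hA⟩ := bound_aux (f := Phi l v) (g := fun z =>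
    ((1 - l * cj l) * ((1 - cj l * z)⁻¹ * (1 - l * cj z)⁻¹)) ^ 2 *
    (v * cj v * (1 - mob l z * cj (mob l z)) *
      (2 * ((1 - cj v * mob l z) * (1 - v * cj (mob l z))) + 2
    - v * cj v * (1 + mob l z * cj (mob l z))) *
      ((1 - cj v * mob l z)⁻¹ ^ 2 * (1 - v * cj (mob l z))⁻¹ ^ 2))) (by fun_prop)
    (fun z hz => by
      have h := mob_rho (hs (ball_subset_closedBall hz)).1
      unfold Phi Psi
      rw [pow_succ]
      nth_rw 1 [h]
      generalize 1 - cj l * z = p at *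
      generalize 1 - l * cj z = q at *
      generalize (1 - mob l z * cj (mob l z)) = r at *
      generalize (1 - cj v * mob l z)⁻¹ ^ 2 * (1 - v * cj (mob l z))⁻¹ ^ 2 = r1 at *
      generalize (2 * ((1 - cj v * mob l z) * (1 - v * cj (mob l z))) + 2
    - v * cj v * (1 + mob l z * cj (mob l z))) = r2 at *
      ring)
  obtain ⟨B, hB⟩ := bound_aux (f := wd (Phi l v)) (g := fun z =>
    ((1 - l * cj l) * ((1 - cj l * z)⁻¹ * (1 - l * cj z)⁻¹)) ^ 2 *
    (PsiXr v (mob l z) * ((1 - l * cj l) * (1 - cj l * z)⁻¹ ^ 2))) (by fun_prop)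
    (fun z hz => by
      have hz' := hs (ball_subset_closedBall hz)
      have h := mob_rho hz'.1
      rw [wd_Phi hz']
      unfold PsiX mob'
      rw [h]
      generalize 1 - cj l * z = p at *
      generalize 1 - l * cj z = q at *
      ring)
  refine ⟨max A B, fun z hz => (hA z hz).trans ?_, fun z hz => (hB z hz).trans ?_⟩
  · gcongr; exact le_max_left _ _
  · gcongr; exact le_max_right _ _

section subharm
variable {u : ℂ → ℝ}

lemma hasW_real {z : ℂ} (hu : DifferentiableAt ℝ u z) :
    HasW (fun z => (u z : ℂ)) (cj ((fderiv ℝ u z 1 + I * fderiv ℝ u z I) / 2))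
      ((fderiv ℝ u z 1 + I * fderiv ℝ u z I) / 2) z := by
  have h1 : HasFDerivAt (𝕜 := ℝ) (fun z => (u z : ℂ)) (ofRealCLM.comp (fderiv ℝ u z)) z :=
    ofRealCLM.hasFDerivAt.comp z hu.hasFDerivAt
  have h2 := hasW_of_diff h1.differentiableAt
  refine h2.eq' ?_ ?_
  · have h22 : cj (2:ℂ) = 2 := map_ofNat _ 2
    unfold wd; rw [h1.fderiv]; simp only [map_div₀, h22]; simp; ring
  · unfold wdb; rw [h1.fderiv]; simp

lemma contDiffOn_fderiv_real {U : Set ℂ} (hU : IsOpen U)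
    (hf : ContDiffOn ℝ 2 u U) (v : ℂ) :
    ContDiffOn ℝ 1 (fun z => fderiv ℝ u z v) U :=
  (hf.fderiv_of_isOpen hU (by norm_num)).clm_apply contDiffOn_const

lemma hasW_real2 {U : Set ℂ} (hU : IsOpen U) (hu : ContDiffOn ℝ 2 u U) {z : ℂ} (hz : z ∈ U) :
    ∃ α β : ℂ, HasW (fun z => ((fderiv ℝ u z 1 + I * fderiv ℝ u z I) / 2 : ℂ)) α β z ∧
      α.re = lapR u z := by
  have h1 : DifferentiableAt ℝ (fun z => fderiv ℝ u z 1) z :=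
    ((contDiffOn_fderiv_real hU hu 1).contDiffAt (hU.mem_nhds hz)).differentiableAt (by norm_num)
  have h2 : DifferentiableAt ℝ (fun z => fderiv ℝ u z I) z :=
    ((contDiffOn_fderiv_real hU hu I).contDiffAt (hU.mem_nhds hz)).differentiableAt (by norm_num)
  have := ((hasW_real h1).add ((HasW.const I z).mul (hasW_real h2))).mul (HasW.const (1/2) z)
  refine ⟨_, _, this.congr ?_, ?_⟩
  · filter_upwards with x; ring
  · have h22 : cj (2:ℂ) = 2 := map_ofNat _ 2
    unfold lapR
    simp only [map_div₀, h22, div_eq_mul_inv, map_add, map_mul, conj_I, conj_ofReal]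
    simp
    ring

/-- `E = e^u |H|²` -/
def EE (u : ℂ → ℝ) (H : ℂ → ℂ) (z : ℂ) : ℂ := Complex.exp (u z) * (H z * cj (H z))

lemma contDiffOn_EE {U : Set ℂ} (hU : IsOpen U) (hu : ContDiffOn ℝ 2 u U) {H : ℂ → ℂ}
    (hH : DifferentiableOn ℂ H U) : ContDiffOn ℝ 2 (EE u H) U := by
  have h1 : ContDiffOn ℝ 2 H U := (hH.contDiffOn hU).restrict_scalars ℝ
  have h2 : ContDiffOn ℝ 2 (fun z => cj (H z)) U := contDiff_cj.comp_contDiffOn h1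
  have h3 : ContDiffOn ℝ 2 (fun z => (u z : ℂ)) U := ofRealCLM.contDiff.comp_contDiffOn hu
  exact (h3.cexp).mul (h1.mul h2)

lemma EE_subharm {U : Set ℂ} (hU : IsOpen U) (hu : ContDiffOn ℝ 2 u U) {H : ℂ → ℂ}
    (hH : DifferentiableOn ℂ H U) {z : ℂ} (hz : z ∈ U) (hl : 0 ≤ lapR u z) :
    0 ≤ (wd (wdb (EE u H)) z).re := by
  set g : ℂ → ℂ := fun z => ((fderiv ℝ u z 1 + I * fderiv ℝ u z I) / 2 : ℂ) with hg
  have hexp : ∀ x ∈ U, HasW (fun z => Complex.exp (u z)) (Complex.exp (u x) * cj (g x))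
      (Complex.exp (u x) * g x) x := fun x hx =>
    HasW.comp_hol (Complex.hasDerivAt_exp _)
      (hasW_real ((hu.contDiffAt (hU.mem_nhds hx)).differentiableAt (by norm_num)))
  have hHx : ∀ x ∈ U, HasW H (deriv H x) 0 x := fun x hx =>
    HasW.of_deriv (hH.differentiableAt (hU.mem_nhds hx)).hasDerivAt
  have hH'x : ∀ x ∈ U, HasW (deriv H) (deriv (deriv H) x) 0 x := fun x hx =>
    HasW.of_deriv ((hH.deriv hU).differentiableAt (hU.mem_nhds hx)).hasDerivAt
  have h1 : ∀ x ∈ U, wdb (EE u H) x =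
      Complex.exp (u x) * (H x * (g x * cj (H x) + cj (deriv H x))) := fun x hx => by
    refine (show wdb (EE u H) x = _ from
      ((hexp x hx).mul ((hHx x hx).mul (hHx x hx).conj)).wdb_eq).trans ?_
    ring
  obtain ⟨α, β, hα, hre⟩ := hasW_real2 hU hu hz
  have h2 := (hexp z hz).mul ((hHx z hz).mul ((hα.mul (hHx z hz).conj).add (hH'x z hz).conj))
  have h3 := h2.congr (g := wdb (EE u H)) (by
    filter_upwards [hU.mem_nhds hz] with x hx using h1 x hx)
  rw [h3.wd_eq]
  have h4 : Complex.exp (u z) * cj (g z) * (H z * (g z * cj (H z) + cj (deriv H z))) +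
      Complex.exp (u z) * (deriv H z * (g z * cj (H z) + cj (deriv H z)) +
        H z * (α * cj (H z) + g z * cj 0 + cj 0)) =
      Complex.exp (u z) * ((g z * cj (H z) + cj (deriv H z)) *
        cj (g z * cj (H z) + cj (deriv H z)) + (H z * cj (H z)) * α) := by
    simp only [map_add, map_mul, conj_conj, map_zero]
    ring
  have h5 : (Complex.exp (u z) * ((g z * cj (H z) + cj (deriv H z)) *
        cj (g z * cj (H z) + cj (deriv H z)) + (H z * cj (H z)) * α)).re =
      Real.exp (u z) * (‖g z * cj (H z) + cj (deriv H z)‖ ^ 2 + ‖H z‖ ^ 2 * lapR u z) := by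
    rw [mul_conj', mul_conj', ← ofReal_exp, re_ofReal_mul, add_re, ← hre]
    norm_cast
    rw [re_ofReal_mul]
  refine le_of_le_of_eq ?_ (h5.symm.trans (congrArg Complex.re h4).symm)
  positivity

end subharm

lemma scale_W {f : ℂ → ℂ} {s : ℝ} {z : ℂ} (hf : DifferentiableAt ℝ f (s * z)) :
    HasW (fun z => f (s * z)) (wd f (s * z) * s) (wdb f (s * z) * s) z := by
  have := HasW.comp_inner (f := f) (φ := fun z => s * z) (z := z) (hasW_of_diff hf)
    (by simpa using (hasDerivAt_id z).const_mul (s : ℂ))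
  simpa using this

lemma scale_wd_wdb {f : ℂ → ℂ} {U : Set ℂ} (hU : IsOpen U) (hf : ContDiffOn ℝ 2 f U) {s : ℝ}
    {z : ℂ} (hz : s * z ∈ U) :
    wd (wdb (fun z => f (s * z))) z = s ^ 2 * wd (wdb f) (s * z) := by
  have h1 : wdb (fun z => f (s * z)) =ᶠ[nhds z] fun z => wdb f (s * z) * s := by
    have : {z : ℂ | s * z ∈ U} ∈ nhds z :=
      (hU.preimage (by fun_prop : Continuous fun z : ℂ => (s:ℂ) * z)).mem_nhds hz
    filter_upwards [this] with x hx
    exact (scale_W ((hf.contDiffAt (hU.mem_nhds hx)).differentiableAt (by norm_num))).wdb_eq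
  have h2 : ContDiffOn ℝ 1 (wdb f) U := contDiffOn_wdb (n := 2) (m := 1) hU hf (by norm_num)
  have h3 := (scale_W (f := wdb f) (s := s) (z := z)
    ((h2.contDiffAt (hU.mem_nhds hz)).differentiableAt (by norm_num))).mul (HasW.const (s:ℂ) z)
  rw [(h3.congr h1).wd_eq]
  ring

lemma scaled_ineq {E : ℂ → ℂ} (hE : ContDiffOn ℝ 2 E (ball 0 1))
    (hsub : ∀ z ∈ ball (0:ℂ) 1, 0 ≤ (wd (wdb E) z).re) {l v : ℂ} (hl : ‖l‖ < 1) (hv : ‖v‖ < 1)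
    {s : ℝ} (hs0 : 0 < s) (hs1 : s < 1) :
    0 ≤ (∫ z in ball (0:ℂ) 1, E (s * z) * wdb (wd (Phi l v)) z).re := by
  have hmem : ∀ z ∈ closedBall (0:ℂ) 1, (s:ℂ) * z ∈ ball (0:ℂ) 1 := by
    intro z hz
    have : ‖z‖ ≤ 1 := by simpa using hz
    simp only [mem_ball, dist_zero_right, norm_mul, norm_real, Real.norm_of_nonneg hs0.le]
    nlinarith
  set U : Set ℂ := USet l v ∩ {z : ℂ | (s:ℂ) * z ∈ ball (0:ℂ) 1} with hU
  have hUo : IsOpen U := (USet_open l v).inter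
    (isOpen_ball.preimage (by fun_prop : Continuous fun z : ℂ => (s:ℂ) * z))
  have hUs : closedBall (0:ℂ) 1 ⊆ U := fun z hz => ⟨USet_sub hl hv hz, hmem z hz⟩
  have he : ContDiffOn ℝ 2 (fun z => E (s * z)) U :=
    hE.comp (contDiff_const.mul contDiff_id).contDiffOn (fun z hz => hz.2)
  obtain ⟨C, hC1, hC2⟩ := Phi_bounds hl hv
  rw [green hUo hUs he ((contDiffOn_Phi l v).mono inter_subset_left) hC1 hC2]
  have hi : IntegrableOn (fun z => Phi l v z * wd (wdb (fun z => E (s * z))) z) (ball (0:ℂ) 1) := by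
    apply contOn_int
    have h1 : ContDiffOn ℝ 1 (wdb (fun z => E (s * z))) U :=
      contDiffOn_wdb (n := 2) (m := 1) hUo he (by norm_num)
    have h2 : ContDiffOn ℝ 0 (wd (wdb (fun z => E (s * z)))) U :=
      contDiffOn_wd (n := 1) (m := 0) hUo h1 (by norm_num)
    exact ((contDiffOn_Phi l v).continuousOn.mono (hUs.trans inter_subset_left)).mul
      (h2.continuousOn.mono hUs)
  have h3 : (∫ z in ball (0:ℂ) 1, Phi l v z * wd (wdb (fun z => E (s * z))) z).re =
      ∫ z in ball (0:ℂ) 1, (Phi l v z * wd (wdb (fun z => E (s * z))) z).re := by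
    have := integral_re hi
    exact this.symm
  rw [h3]
  apply setIntegral_nonneg measurableSet_ball
  intro z hz
  have hz1 : ‖z‖ < 1 := by simpa using hz
  have hsz := hmem z (ball_subset_closedBall hz)
  rw [scale_wd_wdb isOpen_ball hE hsz]
  obtain ⟨r, hr, hre⟩ := psi_nonneg hv.le (mob_norm hl hz1).le
  unfold Phi
  rw [hre, re_ofReal_mul]
  apply mul_nonneg hr
  rw [← ofReal_pow, re_ofReal_mul]
  exact mul_nonneg (sq_nonneg s) (hsub _ hsz)

lemma L_factor {l v : ℂ} (hl : ‖l‖ < 1) (hv : ‖v‖ < 1) : ∃ B : ℝ, ∀ z ∈ ball (0:ℂ) 1,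
    ‖wdb (wd (Phi l v)) z‖ ≤ (1 - ‖z‖ ^ 2) * B := by
  have hs := USet_sub hl hv
  have cm : ContinuousOn (mob l) (closedBall 0 1) := (mob_contOn l).mono fun _ hz => (hs hz).1
  have cd : ContinuousOn (fun z : ℂ => (1 - cj l * z)⁻¹) (closedBall 0 1) :=
    ContinuousOn.inv₀ (by fun_prop) (fun z hz => (hs hz).1)
  have cdc : ContinuousOn (fun z : ℂ => (1 - l * cj z)⁻¹) (closedBall 0 1) :=
    ContinuousOn.inv₀ (by fun_prop) (fun z hz => pc_ne (hs hz).1)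
  have cp : ContinuousOn (fun z : ℂ => (1 - cj v * mob l z)⁻¹) (closedBall 0 1) :=
    ContinuousOn.inv₀ (by fun_prop) (fun z hz => (hs hz).2)
  have cpc : ContinuousOn (fun z : ℂ => (1 - v * cj (mob l z))⁻¹) (closedBall 0 1) :=
    ContinuousOn.inv₀ (by fun_prop) (fun z hz => pc_ne (hs hz).2)
  have cm' : ContinuousOn (mob' l) (closedBall 0 1) := by
    have : mob' l = fun z => (1 - l * cj l) * (1 - cj l * z)⁻¹ ^ 2 := by
      ext z; rw [mob', inv_pow, div_eq_mul_inv]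
    rw [this]; fun_prop
  obtain ⟨B, hB, hBz⟩ := bdd_of_cont (g := fun z =>
    4 * ((1 - l * cj l) * ((1 - cj l * z)⁻¹ * (1 - l * cj z)⁻¹)) *
    ((1 - v * cj v) ^ 3 * ((1 - cj v * mob l z)⁻¹ ^ 3 * (1 - v * cj (mob l z))⁻¹ ^ 3)
    - (1 - cj v * mob l z)⁻¹ ^ 3 - (1 - v * cj (mob l z))⁻¹ ^ 3 + 1) * (mob' l z * cj (mob' l z)))
    (by fun_prop)
  refine ⟨B, fun z hz => ?_⟩
  have hz' := hs (ball_subset_closedBall hz)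
  have hz1 : ‖z‖ < 1 := by simpa using hz
  have hpos : 0 ≤ 1 - ‖z‖ ^ 2 := by have := norm_nonneg z; nlinarith
  have key : wdb (wd (Phi l v)) z = ((1 - ‖z‖ ^ 2 : ℝ) : ℂ) *
    (4 * ((1 - l * cj l) * ((1 - cj l * z)⁻¹ * (1 - l * cj z)⁻¹)) *
    ((1 - v * cj v) ^ 3 * ((1 - cj v * mob l z)⁻¹ ^ 3 * (1 - v * cj (mob l z))⁻¹ ^ 3)
    - (1 - cj v * mob l z)⁻¹ ^ 3 - (1 - v * cj (mob l z))⁻¹ ^ 3 + 1)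
      * (mob' l z * cj (mob' l z))) := by
    rw [wdb_wd_Phi hz', ← rho_real]
    unfold PsiL
    rw [mob_rho hz'.1, div_eq_mul_inv, mul_inv]
    ring
  rw [key, norm_mul, norm_real, Real.norm_of_nonneg hpos]
  exact mul_le_mul_of_nonneg_left (hBz z (ball_subset_closedBall hz)) hpos

lemma limit_ineq {E : ℂ → ℂ} (hE : ContDiffOn ℝ 2 E (ball 0 1))
    (hsub : ∀ z ∈ ball (0:ℂ) 1, 0 ≤ (wd (wdb E) z).re) {l v : ℂ} (hl : ‖l‖ < 1) (hv : ‖v‖ < 1)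
    {A : ℝ} (hA : ∀ z ∈ ball (0:ℂ) 1, ‖E z‖ * (1 - ‖z‖ ^ 2) ≤ A) :
    0 ≤ (∫ z in ball (0:ℂ) 1, E z * wdb (wd (Phi l v)) z).re := by
  obtain ⟨B, hB⟩ := L_factor hl hv
  have hX : ContDiffOn ℝ 1 (wd (Phi l v)) (USet l v) :=
    contDiffOn_wd (n := 2) (m := 1) (USet_open l v) (contDiffOn_Phi l v) (by norm_num)
  have hL : ContDiffOn ℝ 0 (wdb (wd (Phi l v))) (USet l v) :=
    contDiffOn_wdb (n := 1) (m := 0) (USet_open l v) hX (by norm_num)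
  have cL : ContinuousOn (wdb (wd (Phi l v))) (ball 0 1) :=
    hL.continuousOn.mono (ball_subset_closedBall.trans (USet_sub hl hv))
  have hev : ∀ᶠ s : ℝ in nhdsWithin 1 (Iio 1), 0 < s ∧ s < 1 := by
    filter_upwards [self_mem_nhdsWithin, mem_nhdsWithin_of_mem_nhds (lt_mem_nhds zero_lt_one)]
      with s h1 h2 using ⟨h2, h1⟩
  have hmem : ∀ s : ℝ, 0 < s → s < 1 → ∀ z ∈ ball (0:ℂ) 1, (s:ℂ) * z ∈ ball (0:ℂ) 1 := by
    intro s h0 h1 z hz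
    have : ‖z‖ < 1 := by simpa using hz
    simp only [mem_ball, dist_zero_right, norm_mul, norm_real, Real.norm_of_nonneg h0.le]
    have := norm_nonneg z
    nlinarith
  have ht : Filter.Tendsto (fun s : ℝ => ∫ z in ball (0:ℂ) 1, E (s * z) * wdb (wd (Phi l v)) z)
      (nhdsWithin 1 (Iio 1)) (nhds (∫ z in ball (0:ℂ) 1, E z * wdb (wd (Phi l v)) z)) := by
    apply tendsto_integral_filter_of_dominated_convergence (fun _ => A * B)
    · filter_upwards [hev] with s hs
      apply ContinuousOn.aestronglyMeasurable _ measurableSet_ball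
      exact (hE.continuousOn.comp (by fun_prop) (hmem s hs.1 hs.2)).mul cL
    · filter_upwards [hev] with s hs
      rw [ae_restrict_iff' measurableSet_ball]
      filter_upwards with z hz
      have hz1 : ‖z‖ < 1 := by simpa using hz
      have hn := norm_nonneg z
      have hp : 0 < 1 - ‖z‖ ^ 2 := by nlinarith
      have h1 := hA _ (hmem s hs.1 hs.2 z hz)
      have h2 := hB z hz
      have hB0 : 0 ≤ B := by
        have := (norm_nonneg _).trans h2
        exact nonneg_of_mul_nonneg_right this hp
      have h3 : 1 - ‖z‖ ^ 2 ≤ 1 - ‖(s:ℂ) * z‖ ^ 2 := by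
        have : ‖(s:ℂ) * z‖ ≤ ‖z‖ := by
          rw [norm_mul, norm_real, Real.norm_of_nonneg hs.1.le]
          nlinarith [hs.2]
        have := norm_nonneg ((s:ℂ) * z)
        nlinarith
      rw [norm_mul]
      calc ‖E (s * z)‖ * ‖wdb (wd (Phi l v)) z‖ ≤ ‖E (s * z)‖ * ((1 - ‖z‖ ^ 2) * B) := by gcongr
        _ = (‖E (s * z)‖ * (1 - ‖z‖ ^ 2)) * B := by ring
        _ ≤ (‖E (s * z)‖ * (1 - ‖(s:ℂ) * z‖ ^ 2)) * B := by gcongr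
        _ ≤ A * B := by gcongr
    · exact integrableOn_const (by exact measure_ball_lt_top.ne)
    · rw [ae_restrict_iff' measurableSet_ball]
      filter_upwards with z hz
      apply Filter.Tendsto.mul_const
      have hc : ContinuousAt E z := hE.continuousOn.continuousAt (isOpen_ball.mem_nhds hz)
      have h1 : Filter.Tendsto (fun s : ℝ => (s : ℂ) * z) (nhdsWithin 1 (Iio 1)) (nhds z) := by
        have : Filter.Tendsto (fun s : ℝ => (s : ℂ) * z) (nhds 1) (nhds (((1:ℝ) : ℂ) * z)) :=
          (by fun_prop : Continuous fun s : ℝ => (s : ℂ) * z).tendsto 1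
        simp only [ofReal_one, one_mul] at this
        exact this.mono_left nhdsWithin_le_nhds
      exact hc.tendsto.comp h1
  have ht' := (Complex.continuous_re.tendsto _).comp ht
  refine ge_of_tendsto ht' ?_
  filter_upwards [hev] with s hs
  exact scaled_ineq hE hsub hl hv hs.1 hs.2

lemma alg_aux {r d dc P Pc a w F Fc q : ℂ} (hr : r ≠ 0) (hd : d ≠ 0) (hdc : dc ≠ 0) (hP : P ≠ 0)
    (hPc : Pc ≠ 0) :
    (w / r * (F * P ^ 3 * d ^ 3 * (Fc * Pc ^ 3 * dc ^ 3))) *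
      ((4 * (r * (a / (d * dc))) * (q ^ 3 * (P⁻¹ ^ 3 * Pc⁻¹ ^ 3) - P⁻¹ ^ 3 - Pc⁻¹ ^ 3 + 1)) *
        ((a / d ^ 2) * (a / dc ^ 2))) =
      4 * a ^ 3 * (w * (F * Fc) * ((1 - P ^ 3) * (1 - Pc ^ 3) - (1 - q ^ 3))) := by
  field_simp
  ring

lemma pointwise_id {ω : ℂ → ℝ} {F : ℂ → ℂ} {l v z : ℂ} (hl : ‖l‖ < 1) (hv : ‖v‖ < 1)
    (hz : ‖z‖ < 1) (hω : 0 < ω z) :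
    EE (fun z => Real.log (ω z / (1 - ‖z‖ ^ 2)))
      (fun z => F z * (1 - cj v * mob l z) ^ 3 * (1 - cj l * z) ^ 3) z * wdb (wd (Phi l v)) z =
    ((4 * (1 - ‖l‖ ^ 2) ^ 3 * (ω z * ‖F z‖ ^ 2 *
      (‖1 - (1 - cj v * mob l z) ^ 3‖ ^ 2 - (1 - (1 - ‖v‖ ^ 2) ^ 3))) : ℝ) : ℂ) := by
  have hU := USet_sub hl hv (show z ∈ closedBall (0:ℂ) 1 by simpa using hz.le)
  have hr : 0 < 1 - ‖z‖ ^ 2 := by nlinarith [norm_nonneg z]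
  have hr' : 1 - z * cj z ≠ 0 := by
    rw [rho_real]; exact_mod_cast hr.ne'
  rw [wdb_wd_Phi hU]
  unfold EE PsiL
  rw [mob_rho hU.1]
  have h1 : Complex.exp ((Real.log (ω z / (1 - ‖z‖ ^ 2)) : ℝ) : ℂ) = (ω z : ℂ) / (1 - z * cj z) := by
    rw [← ofReal_exp, Real.exp_log (div_pos hω hr), rho_real, ofReal_div]
  have h2 : mob' l z * cj (mob' l z) =
      ((1 - l * cj l) / (1 - cj l * z) ^ 2) * ((1 - l * cj l) / (1 - l * cj z) ^ 2) := by
    unfold mob'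
    simp only [map_div₀, map_sub, map_one, map_mul, conj_conj, map_pow]
    rw [mul_comm (cj l) l]
  have h3 : cj (F z * (1 - cj v * mob l z) ^ 3 * (1 - cj l * z) ^ 3) =
      cj (F z) * (1 - v * cj (mob l z)) ^ 3 * (1 - l * cj z) ^ 3 := by
    simp
  rw [h1, h2, h3, alg_aux hr' hU.1 (pc_ne hU.1) hU.2 (pc_ne hU.2)]
  have h4 : (1 - (1 - v * cj (mob l z)) ^ 3) = cj (1 - (1 - cj v * mob l z) ^ 3) := by simp
  rw [h4, rho_real, rho_real, mul_conj', mul_conj']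
  push_cast
  ring

lemma u_smooth {ω : ℂ → ℝ} (hωpos : ∀ z ∈ closedBall (0:ℂ) 1, 0 < ω z)
    (hωsmooth : ContDiffOn ℝ (⊤ : ℕ∞) ω (closedBall (0:ℂ) 1)) :
    ContDiffOn ℝ 2 (fun z : ℂ => Real.log (ω z / (1 - ‖z‖ ^ 2))) (ball 0 1) := by
  have h1 : ContDiffOn ℝ 2 ω (ball 0 1) :=
    (hωsmooth.of_le (WithTop.coe_le_coe.mpr (le_top : (2:ℕ∞) ≤ ⊤))).mono ball_subset_closedBall
  have h2 : ContDiffOn ℝ 2 (fun z : ℂ => 1 - ‖z‖ ^ 2) (ball 0 1) :=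
    (contDiff_const.sub (contDiff_norm_sq ℝ)).contDiffOn
  have hr : ∀ z ∈ ball (0:ℂ) 1, 0 < 1 - ‖z‖ ^ 2 := fun z hz => by
    have : ‖z‖ < 1 := by simpa using hz
    nlinarith [norm_nonneg z]
  exact (h1.div h2 fun z hz => (hr z hz).ne').log fun z hz =>
    (div_pos (hωpos z (ball_subset_closedBall hz)) (hr z hz)).ne'

lemma p_cont {l v : ℂ} (hl : ‖l‖ < 1) (hv : ‖v‖ < 1) :
    ContinuousOn (fun z => 1 - cj v * mob l z) (closedBall 0 1) :=
  continuousOn_const.sub (continuousOn_const.mul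
    ((mob_contOn l).mono fun _ hz => (USet_sub hl hv hz).1))

lemma p_diff {l v : ℂ} (hl : ‖l‖ < 1) (hv : ‖v‖ < 1) :
    DifferentiableOn ℂ (fun z => 1 - cj v * mob l z) (ball 0 1) := by
  have h1 : DifferentiableOn ℂ (mob l) (ball 0 1) := fun z hz =>
    (hasDerivAt_mob (USet_sub hl hv (ball_subset_closedBall hz)).1).differentiableAt.differentiableWithinAt
  exact (differentiableOn_const _).sub ((differentiableOn_const _).mul h1)

lemma key_ineq {ω : ℂ → ℝ} (hωpos : ∀ z ∈ closedBall (0:ℂ) 1, 0 < ω z)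
    (hωsmooth : ContDiffOn ℝ (⊤ : ℕ∞) ω (closedBall (0:ℂ) 1))
    (hsub : ∀ z ∈ ball (0:ℂ) 1, 0 ≤ lapR (fun z => Real.log (ω z / (1 - ‖z‖ ^ 2))) z)
    {F : ℂ → ℂ} (hF : DifferentiableOn ℂ F (ball 0 1)) (hFc : ContinuousOn F (closedBall 0 1))
    {l v : ℂ} (hl : ‖l‖ < 1) (hv : ‖v‖ < 1) :
    0 ≤ ∫ z in ball (0:ℂ) 1, ω z * ‖F z‖ ^ 2 *
      (‖1 - (1 - cj v * mob l z) ^ 3‖ ^ 2 - (1 - (1 - ‖v‖ ^ 2) ^ 3)) := by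
  set u : ℂ → ℝ := fun z => Real.log (ω z / (1 - ‖z‖ ^ 2)) with hu
  set H : ℂ → ℂ := fun z => F z * (1 - cj v * mob l z) ^ 3 * (1 - cj l * z) ^ 3 with hH
  have us := u_smooth hωpos hωsmooth
  have Hd : DifferentiableOn ℂ H (ball 0 1) :=
    (hF.mul ((p_diff hl hv).pow 3)).mul (by fun_prop)
  have Hc : ContinuousOn H (closedBall 0 1) :=
    (hFc.mul ((p_cont hl hv).pow 3)).mul (by fun_prop)
  have hcc : ContinuousOn (fun z => (ω z : ℂ) * (H z * H z)) (closedBall 0 1) :=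
    (continuous_ofReal.comp_continuousOn hωsmooth.continuousOn).mul (Hc.mul Hc)
  obtain ⟨A, hA0, hA⟩ := bdd_of_cont hcc
  have hlim := limit_ineq (E := EE u H) (contDiffOn_EE isOpen_ball us Hd)
    (fun z hz => EE_subharm isOpen_ball us Hd hz (hsub z hz)) hl hv (A := A) (by
      intro z hz
      have hz1 : ‖z‖ < 1 := by simpa using hz
      have hr : 0 < 1 - ‖z‖ ^ 2 := by nlinarith [norm_nonneg z]
      have hw := hωpos z (ball_subset_closedBall hz)
      refine le_of_eq_of_le ?_ (hA z (ball_subset_closedBall hz))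
      unfold EE
      rw [norm_mul, ← ofReal_exp, norm_real, Real.norm_of_nonneg (Real.exp_pos _).le, hu,
        Real.exp_log (div_pos hw hr), norm_mul (H z), norm_mul (ω z : ℂ), norm_mul (H z), norm_real,
        Real.norm_of_nonneg hw.le, RCLike.norm_conj]
      field_simp)
  have heq : ∫ z in ball (0:ℂ) 1, EE u H z * wdb (wd (Phi l v)) z =
      ∫ z in ball (0:ℂ) 1, ((4 * (1 - ‖l‖ ^ 2) ^ 3 * (ω z * ‖F z‖ ^ 2 *
      (‖1 - (1 - cj v * mob l z) ^ 3‖ ^ 2 - (1 - (1 - ‖v‖ ^ 2) ^ 3))) : ℝ) : ℂ) := by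
    apply setIntegral_congr_fun measurableSet_ball
    intro z hz
    exact pointwise_id hl hv (by simpa using hz) (hωpos z (ball_subset_closedBall hz))
  rw [heq, integral_complex_ofReal, ofReal_re, integral_const_mul] at hlim
  have : 0 < 4 * (1 - ‖l‖ ^ 2) ^ 3 := by
    have : 0 < 1 - ‖l‖ ^ 2 := by nlinarith [norm_nonneg l]
    positivity
  exact nonneg_of_mul_nonneg_right hlim this

lemma contOn_int_sigma {G : Type*} [NormedAddCommGroup G] {g : ℂ → G}
    (hg : ContinuousOn g (closedBall 0 1)) : IntegrableOn g (ball (0:ℂ) 1) dSigma := by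
  have h := (hg.integrableOn_compact (μ := volume) (isCompact_closedBall 0 1)).mono_set
    (ball_subset_closedBall (x := (0:ℂ)) (ε := 1))
  unfold dSigma IntegrableOn
  rw [Measure.restrict_smul]
  exact h.smul_measure ENNReal.ofReal_ne_top

lemma sigma_nonneg {g : ℂ → ℝ} (h : 0 ≤ ∫ z in ball (0:ℂ) 1, g z) :
    0 ≤ ∫ z in ball (0:ℂ) 1, g z ∂dSigma := by
  unfold dSigma
  rw [Measure.restrict_smul, integral_smul_measure]
  exact smul_nonneg ENNReal.toReal_nonneg h

lemma memA2_of_cont {ω : ℂ → ℝ} (hω : ContinuousOn ω (closedBall (0:ℂ) 1)) {f : ℂ → ℂ}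
    (hf : DifferentiableOn ℂ f (ball 0 1)) (hfc : ContinuousOn f (closedBall 0 1)) : MemA2 ω f :=
  ⟨hf, contOn_int_sigma ((hfc.norm.pow 2).mul hω)⟩

lemma quad {ω : ℂ → ℝ} (hωpos : ∀ z ∈ closedBall (0:ℂ) 1, 0 < ω z)
    (hω : ContinuousOn ω (closedBall (0:ℂ) 1)) {k f : ℂ → ℂ} {w : ℂ}
    (hkc : ContinuousOn k (closedBall 0 1)) (hk : Reproduces ω k w)
    (hf : DifferentiableOn ℂ f (ball 0 1)) (hfc : ContinuousOn f (closedBall 0 1)) (t : ℝ) :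
    0 ≤ (∫ z in ball (0:ℂ) 1, ‖f z‖ ^ 2 * ω z ∂dSigma) - 2 * t * (f w).re +
      t ^ 2 * ∫ z in ball (0:ℂ) 1, ‖k z‖ ^ 2 * ω z ∂dSigma := by
  have hrep : ∫ z in ball (0:ℂ) 1, f z * cj (k z) * (ω z : ℂ) ∂dSigma = f w :=
    hk.2 f (memA2_of_cont hω hf hfc)
  have hωC : ContinuousOn (fun z => (ω z : ℂ)) (closedBall 0 1) :=
    continuous_ofReal.comp_continuousOn hω
  have hi0 : IntegrableOn (fun z => f z * cj (k z) * (ω z : ℂ)) (ball (0:ℂ) 1) dSigma :=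
    contOn_int_sigma ((hfc.mul (continuous_conj.comp_continuousOn hkc)).mul hωC)
  have h1 : ∫ z in ball (0:ℂ) 1, (f z * cj (k z) * (ω z : ℂ)).re ∂dSigma = (f w).re := by
    rw [← hrep]; exact integral_re hi0
  have i1 : IntegrableOn (fun z => ‖f z‖ ^ 2 * ω z) (ball (0:ℂ) 1) dSigma :=
    contOn_int_sigma ((hfc.norm.pow 2).mul hω)
  have i3 : IntegrableOn (fun z => ‖k z‖ ^ 2 * ω z) (ball (0:ℂ) 1) dSigma :=
    contOn_int_sigma ((hkc.norm.pow 2).mul hω)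
  have i2 : IntegrableOn (fun z => (f z * cj (k z) * (ω z : ℂ)).re) (ball (0:ℂ) 1) dSigma :=
    hi0.re
  have i4 : IntegrableOn (fun z => ‖f z‖ ^ 2 * ω z - 2 * t * (f z * cj (k z) * (ω z : ℂ)).re)
      (ball (0:ℂ) 1) dSigma := i1.sub (i2.const_mul _)
  rw [← h1, ← integral_const_mul, ← integral_const_mul, ← integral_sub i1 (i2.const_mul _),
    ← integral_add i4 (i3.const_mul _)]
  apply setIntegral_nonneg measurableSet_ball
  intro z hz
  have hw := hωpos z (ball_subset_closedBall hz)
  have : ‖f z‖ ^ 2 * ω z - 2 * t * (f z * cj (k z) * (ω z : ℂ)).re + t ^ 2 * (‖k z‖ ^ 2 * ω z) =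
      ‖f z - t * k z‖ ^ 2 * ω z := by
    rw [← normSq_eq_norm_sq, ← normSq_eq_norm_sq, ← normSq_eq_norm_sq]
    simp [normSq_apply]
    ring
  rw [this]
  positivity

lemma q_ne {p : ℂ} (hp : 0 < p.re) : 1 + p + p ^ 2 ≠ 0 := by
  intro h
  have h1 := congrArg Complex.re h
  have h2 := congrArg Complex.im h
  simp [pow_two] at h1 h2
  have h3 : p.im * (1 + 2 * p.re) = 0 := by linarith
  rcases mul_eq_zero.mp h3 with h4 | h4
  · rw [h4] at h1; nlinarith
  · linarith

lemma p_re {l v z : ℂ} (hl : ‖l‖ < 1) (hv : ‖v‖ < 1) (hz : ‖z‖ ≤ 1) :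
    0 < (1 - cj v * mob l z).re := by
  have h1 : ‖cj v * mob l z‖ < 1 := by
    rw [norm_mul, RCLike.norm_conj]
    have := mob_norm_le hl hz
    nlinarith [norm_nonneg v, norm_nonneg (mob l z)]
  have := (re_le_norm (cj v * mob l z)).trans_lt h1
  rw [sub_re, one_re]
  linarith

lemma main_contra {ω : ℂ → ℝ} (hωpos : ∀ z ∈ closedBall (0:ℂ) 1, 0 < ω z)
    (hωsmooth : ContDiffOn ℝ (⊤ : ℕ∞) ω (closedBall (0:ℂ) 1))
    (hsub : ∀ z ∈ ball (0:ℂ) 1, 0 ≤ lapR (fun z => Real.log (ω z / (1 - ‖z‖ ^ 2))) z)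
    {k : ℂ → ℂ} {w l : ℂ} (hw : ‖w‖ < 1) (hl : ‖l‖ < 1)
    (hk : DifferentiableOn ℂ k (ball 0 1)) (hkc : ContinuousOn k (closedBall 0 1))
    (hr : Reproduces ω k w) (hkl : k l = 0) : False := by
  have hω := hωsmooth.continuousOn
  set κ := ∫ z in ball (0:ℂ) 1, ‖k z‖ ^ 2 * ω z ∂dSigma with hκ
  have hkw : k w = (κ : ℂ) := by
    have h1 : ∫ z in ball (0:ℂ) 1, k z * cj (k z) * (ω z : ℂ) ∂dSigma = k w := hr.2 k hr.1
    rw [← h1, hκ, ← integral_complex_ofReal]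
    congr 1
    ext z
    rw [mul_conj']
    push_cast
    rfl
  have hκpos : 0 < κ := by
    by_contra hneg
    push Not at hneg
    have h1 := quad hωpos hω (f := fun _ => 1) hkc hr (by fun_prop) (by fun_prop)
    set N := ∫ z in ball (0:ℂ) 1, ‖(1:ℂ)‖ ^ 2 * ω z ∂dSigma with hN
    have h2 := h1 0
    have h3 := h1 (N + 1)
    simp only [one_re] at h2 h3
    have h4 : (N + 1) ^ 2 * κ ≤ 0 := mul_nonpos_of_nonneg_of_nonpos (sq_nonneg _) hneg
    rw [← hκ] at h3
    linarith
  have hwl : w ≠ l := by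
    rintro rfl
    rw [hkl] at hkw
    exact hκpos.ne' (by exact_mod_cast hkw.symm)
  set v := mob l w with hvdef
  have hv : ‖v‖ < 1 := mob_norm hl hw
  have hv0 : v ≠ 0 := div_ne_zero (sub_ne_zero.mpr hwl) (mob_den hl hw.le)
  set p : ℂ → ℂ := fun z => 1 - cj v * mob l z with hp
  have pc : ContinuousOn p (closedBall 0 1) := p_cont hl hv
  have pd : DifferentiableOn ℂ p (ball 0 1) := p_diff hl hv
  have pne : ∀ z ∈ closedBall (0:ℂ) 1, cj v * (1 + p z + p z ^ 2) ≠ 0 := fun z hz =>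
    mul_ne_zero ((map_ne_zero _).mpr hv0) (q_ne (p_re hl hv (by simpa using hz)))
  have hlb : l ∈ ball (0:ℂ) 1 := by simpa using hl
  have hwb : w ∈ ball (0:ℂ) 1 := by simpa using hw
  have k1d : DifferentiableOn ℂ (dslope k l) (ball 0 1) :=
    (Complex.differentiableOn_dslope (isOpen_ball.mem_nhds hlb)).mpr hk
  have k1c : ContinuousOn (dslope k l) (closedBall 0 1) :=
    (continuousOn_dslope (Filter.mem_of_superset (isOpen_ball.mem_nhds hlb)
      ball_subset_closedBall)).mpr ⟨hkc, hk.differentiableAt (isOpen_ball.mem_nhds hlb)⟩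
  set F : ℂ → ℂ := fun z => dslope k l z * (1 - cj l * z) / (cj v * (1 + p z + p z ^ 2)) with hF
  have Fd : DifferentiableOn ℂ F (ball 0 1) :=
    (k1d.mul (by fun_prop)).div ((differentiableOn_const _).mul
      (((differentiableOn_const _).add pd).add (pd.pow 2)))
      (fun z hz => pne z (ball_subset_closedBall hz))
  have Fc : ContinuousOn F (closedBall 0 1) :=
    (k1c.mul (by fun_prop)).div (continuousOn_const.mul
      ((continuousOn_const.add pc).add (pc.pow 2))) pne
  have Fb : ∀ z ∈ closedBall (0:ℂ) 1, F z * (1 - p z ^ 3) = k z := by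
    intro z hz
    have h1 := sub_smul_dslope k l z
    rw [hkl, sub_zero, smul_eq_mul] at h1
    have hd := mob_den hl (show ‖z‖ ≤ 1 by simpa using hz)
    have h2 : 1 - p z ^ 3 = (z - l) / (1 - cj l * z) * (cj v * (1 + p z + p z ^ 2)) := by
      have h3 : cj v * ((z - l) / (1 - cj l * z)) = 1 - p z := by
        simp only [hp, mob]; ring
      linear_combination (-(1 + p z + p z ^ 2)) * h3
    rw [h2, ← h1, hF]
    have hq := pne z hz
    simp only
    generalize cj v * (1 + p z + p z ^ 2) = Q at *
    field_simp
  set B : ℝ := 1 - (1 - ‖v‖ ^ 2) ^ 3 with hB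
  have hvn : 0 < ‖v‖ := norm_pos_iff.mpr hv0
  have hv2 : 0 < ‖v‖ ^ 2 := by positivity
  have hv21 : ‖v‖ ^ 2 < 1 := by nlinarith
  have hB0 : 0 < B := by
    have : (1 - ‖v‖ ^ 2) ^ 3 < 1 := pow_lt_one₀ (by linarith) (by linarith) (by norm_num)
    linarith
  have hB1 : B < 1 := by
    have : 0 < (1 - ‖v‖ ^ 2) ^ 3 := pow_pos (by linarith) 3
    linarith
  have hpw : 1 - p w ^ 3 = (B : ℂ) := by
    have : p w = 1 - v * cj v := by simp only [hp, ← hvdef]; ring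
    rw [this, rho_real, hB]; push_cast; ring
  have hFw : (F w).re * B = κ := by
    have h1 := Fb w (ball_subset_closedBall hwb)
    rw [hpw, hkw] at h1
    have := congrArg Complex.re h1
    simpa using this
  have hkey := sigma_nonneg (key_ineq hωpos hωsmooth hsub Fd Fc hl hv)
  set N := ∫ z in ball (0:ℂ) 1, ‖F z‖ ^ 2 * ω z ∂dSigma with hN
  have hkey2 : B * N ≤ κ := by
    have i1 : IntegrableOn (fun z => ‖k z‖ ^ 2 * ω z) (ball (0:ℂ) 1) dSigma :=
      contOn_int_sigma ((hkc.norm.pow 2).mul hω)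
    have i2 : IntegrableOn (fun z => ‖F z‖ ^ 2 * ω z) (ball (0:ℂ) 1) dSigma :=
      contOn_int_sigma ((Fc.norm.pow 2).mul hω)
    have h1 : κ - B * N = ∫ z in ball (0:ℂ) 1, ω z * ‖F z‖ ^ 2 *
        (‖1 - (1 - cj v * mob l z) ^ 3‖ ^ 2 - (1 - (1 - ‖v‖ ^ 2) ^ 3)) ∂dSigma := by
      rw [hκ, hN, ← integral_const_mul, ← integral_sub i1 (i2.const_mul _)]
      apply setIntegral_congr_fun measurableSet_ball
      intro z hz
      simp only
      rw [← Fb z (ball_subset_closedBall hz), norm_mul]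
      simp only [hp, hB]
      ring
    linarith
  have hq := quad hωpos hω hkc hr Fd Fc (1 / B)
  rw [← hN, ← hκ] at hq
  have hFw' : (F w).re = κ / B := by field_simp; linarith
  have hN' : N ≤ κ / B := by rw [le_div_iff₀ hB0]; linarith
  rw [hFw'] at hq
  have h9 : κ / B - 2 * (1 / B) * (κ / B) + (1 / B) ^ 2 * κ = κ / B ^ 2 * (B - 1) := by
    field_simp; ring
  have h10 : κ / B ^ 2 * (B - 1) < 0 := mul_neg_of_pos_of_neg (by positivity) (by linarith)
  linarith

/-- For a strictly positive smooth weight ω on the closed disk with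
log(ω(z)/(1-|z|²)) subharmonic on the disk, any reproducing kernel K for A²(𝔻,ω)
(holomorphic in the first variable, continuous up to the boundary) is zero-free on 𝔻 × 𝔻. -/
theorem statement0 (ω : ℂ → ℝ) (K : ℂ → ℂ → ℂ)
    (hωpos : ∀ z ∈ closedDisk, 0 < ω z)
    (hωsmooth : ContDiffOn ℝ (⊤ : ℕ∞) ω closedDisk)
    (hsub : ∀ z ∈ unitDisk, 0 ≤ lapR (fun z => Real.log (ω z / (1 - ‖z‖ ^ 2))) z)
    (hK : ∀ w ∈ unitDisk,
      DifferentiableOn ℂ (fun z => K z w) unitDisk ∧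
      ContinuousOn (fun z => K z w) closedDisk ∧
      Reproduces ω (fun z => K z w) w) :
    ∀ z ∈ unitDisk, ∀ w ∈ unitDisk, K z w ≠ 0 := by
  intro z hz w hw h0
  obtain ⟨h1, h2, h3⟩ := hK w hw
  exact main_contra hωpos hωsmooth hsub (mem_ball_zero_iff.mp hw) (mem_ball_zero_iff.mp hz)
    h1 h2 h3 h0

end
end

section
/- Let ω be a strictly positive C^∞-smooth weight on the closed unit disk D̄ such that z ↦ log(ω(z)/(1−|z|²)) is subharmonic on D. Suppose K : D̄ × D → ℂ is such that for every w ∈ D the function K(·,w) is holomorphic on D, is continuously differentiable (C¹) on D̄, belongs to A²(D,ω), and reproduces at w for the weight ω. Then K(z,w) ≠ 0 for all z ∈ T and all w ∈ D. -/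
open Complex MeasureTheory Metric Set

noncomputable section

section helpers

lemma diff_dir {f : ℂ → ℝ} {z : ℂ} (hf : ContDiffAt ℝ 2 f z) (e : ℂ) :
    DifferentiableAt ℝ (fun w => fderiv ℝ f w e) z := by
  have h1 : ContDiffAt ℝ 1 (fderiv ℝ f) z := hf.fderiv_right (by norm_num)
  exact (h1.differentiableAt (by norm_num)).clm_apply (differentiableAt_const e)

lemma ev_diff {f : ℂ → ℝ} {z : ℂ} (hf : ContDiffAt ℝ 2 f z) :
    ∀ᶠ w in nhds z, DifferentiableAt ℝ f w := by
  filter_upwards [hf.eventually (by simp)] with w hw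
  exact hw.differentiableAt (by norm_num)

lemma second_mul {f g : ℂ → ℝ} {z : ℂ} (hf : ContDiffAt ℝ 2 f z) (hg : ContDiffAt ℝ 2 g z)
    (e : ℂ) :
    fderiv ℝ (fun w => fderiv ℝ (fun x => f x * g x) w e) z e =
      f z * fderiv ℝ (fun w => fderiv ℝ g w e) z e + g z * fderiv ℝ (fun w => fderiv ℝ f w e) z e
       + 2 * (fderiv ℝ f z e * fderiv ℝ g z e) := by
  have h : (fun w => fderiv ℝ (fun x => f x * g x) w e) =ᶠ[nhds z]
      (fun w => f w * fderiv ℝ g w e + g w * fderiv ℝ f w e) := by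
    filter_upwards [ev_diff hf, ev_diff hg] with w h1 h2
    rw [fderiv_fun_mul h1 h2]; simp
  have df := hf.differentiableAt (by norm_num)
  have dg := hg.differentiableAt (by norm_num)
  rw [h.fderiv_eq, fderiv_fun_add (df.fun_mul (diff_dir hg e)) (dg.fun_mul (diff_dir hf e)),
    fderiv_fun_mul df (diff_dir hg e), fderiv_fun_mul dg (diff_dir hf e)]
  simp
  ring

/-- product rule -/
lemma lap_mul {f g : ℂ → ℝ} {z : ℂ} (hf : ContDiffAt ℝ 2 f z) (hg : ContDiffAt ℝ 2 g z) :
    lapR (fun x => f x * g x) z = f z * lapR g z + g z * lapR f z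
      + (1/2) * (fderiv ℝ f z 1 * fderiv ℝ g z 1 + fderiv ℝ f z I * fderiv ℝ g z I) := by
  unfold lapR
  rw [second_mul hf hg, second_mul hf hg]; ring

lemma second_add {f g : ℂ → ℝ} {z : ℂ} (hf : ContDiffAt ℝ 2 f z) (hg : ContDiffAt ℝ 2 g z)
    (e : ℂ) :
    fderiv ℝ (fun w => fderiv ℝ (fun x => f x + g x) w e) z e =
      fderiv ℝ (fun w => fderiv ℝ f w e) z e + fderiv ℝ (fun w => fderiv ℝ g w e) z e := by
  have h : (fun w => fderiv ℝ (fun x => f x + g x) w e) =ᶠ[nhds z]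
      (fun w => fderiv ℝ f w e + fderiv ℝ g w e) := by
    filter_upwards [ev_diff hf, ev_diff hg] with w h1 h2
    rw [fderiv_fun_add h1 h2]; simp
  rw [h.fderiv_eq, fderiv_fun_add (diff_dir hf e) (diff_dir hg e)]
  simp

lemma lap_add {f g : ℂ → ℝ} {z : ℂ} (hf : ContDiffAt ℝ 2 f z) (hg : ContDiffAt ℝ 2 g z) :
    lapR (fun x => f x + g x) z = lapR f z + lapR g z := by
  unfold lapR
  rw [second_add hf hg, second_add hf hg]; ring

/-- chain rule -/
lemma second_comp {f : ℂ → ℝ} {z : ℂ} (hf : ContDiffAt ℝ 2 f z) (φ φ' : ℝ → ℝ) (φ'' : ℝ)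
    (h1 : ∀ t, HasDerivAt φ (φ' t) t) (h2 : HasDerivAt φ' φ'' (f z)) (e : ℂ) :
    fderiv ℝ (fun w => fderiv ℝ (fun x => φ (f x)) w e) z e =
      φ' (f z) * fderiv ℝ (fun w => fderiv ℝ f w e) z e + φ'' * (fderiv ℝ f z e) ^ 2 := by
  have h : (fun w => fderiv ℝ (fun x => φ (f x)) w e) =ᶠ[nhds z]
      (fun w => φ' (f w) * fderiv ℝ f w e) := by
    filter_upwards [ev_diff hf] with w hw
    have := (h1 (f w)).comp_hasFDerivAt w hw.hasFDerivAt
    rw [show (fun x => φ (f x)) = φ ∘ f from rfl, this.fderiv]; simp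
  have df := hf.differentiableAt (by norm_num)
  have h3 := h2.comp_hasFDerivAt z df.hasFDerivAt
  have h3' : HasFDerivAt (fun x => φ' (f x)) (φ'' • fderiv ℝ f z) z := h3
  rw [h.fderiv_eq, fderiv_fun_mul h3'.differentiableAt (diff_dir hf e), h3'.fderiv]
  simp
  ring

lemma lap_comp {f : ℂ → ℝ} {z : ℂ} (hf : ContDiffAt ℝ 2 f z) (φ φ' : ℝ → ℝ) (φ'' : ℝ)
    (h1 : ∀ t, HasDerivAt φ (φ' t) t) (h2 : HasDerivAt φ' φ'' (f z)) :
    lapR (fun x => φ (f x)) z = φ' (f z) * lapR f z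
      + (1/4) * φ'' * ((fderiv ℝ f z 1) ^ 2 + (fderiv ℝ f z I) ^ 2) := by
  unfold lapR
  rw [second_comp hf φ φ' φ'' h1 h2, second_comp hf φ φ' φ'' h1 h2]; ring

lemma lap_congr {f g : ℂ → ℝ} {z : ℂ} (h : f =ᶠ[nhds z] g) : lapR f z = lapR g z := by
  have key : ∀ e : ℂ, (fun w => fderiv ℝ f w e) =ᶠ[nhds z] (fun w => fderiv ℝ g w e) := by
    intro e
    filter_upwards [h.eventuallyEq_nhds] with w hw
    rw [hw.fderiv_eq]
  unfold lapR
  rw [(key 1).fderiv_eq, (key I).fderiv_eq]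

lemma fderiv_normSq {m : ℂ → ℂ} {z : ℂ} (hm : DifferentiableAt ℂ m z) (e : ℂ) :
    fderiv ℝ (fun x => ‖m x‖ ^ 2) z e = 2 * (starRingEnd ℂ (m z) * (deriv m z * e)).re := by
  have h1 : HasFDerivAt m ((ContinuousLinearMap.toSpanSingleton ℂ (deriv m z)).restrictScalars ℝ) z :=
    hm.hasDerivAt.hasFDerivAt.restrictScalars ℝ
  have h2 := h1.norm_sq
  rw [h2.fderiv]
  simp [Complex.inner]
  ring

lemma contDiffAt_normSq {m : ℂ → ℂ} {z : ℂ} (hm : AnalyticAt ℂ m z) :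
    ContDiffAt ℝ 2 (fun x => ‖m x‖ ^ 2) z := by
  have : ContDiffAt ℝ 2 m z := (hm.contDiffAt (n := 2)).restrict_scalars ℝ
  exact this.norm_sq ℝ

lemma lap_normSq {m : ℂ → ℂ} {z : ℂ} (hm : AnalyticAt ℂ m z) :
    lapR (fun x => ‖m x‖ ^ 2) z = ‖deriv m z‖ ^ 2 := by
  have ev : ∀ᶠ w in nhds z, DifferentiableAt ℂ m w :=
    hm.eventually_analyticAt.mono fun w hw => hw.differentiableAt
  have key : ∀ e : ℂ, fderiv ℝ (fun w => fderiv ℝ (fun x => ‖m x‖ ^ 2) w e) z e =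
      2 * (starRingEnd ℂ (deriv m z * e) * (deriv m z * e)
        + starRingEnd ℂ (m z) * (deriv (deriv m) z * e * e)).re := by
    intro e
    have h : (fun w => fderiv ℝ (fun x => ‖m x‖ ^ 2) w e) =ᶠ[nhds z]
        (fun w => 2 * (starRingEnd ℂ (m w) * (deriv m w * e)).re) := by
      filter_upwards [ev] with w hw
      exact fderiv_normSq hw e
    rw [h.fderiv_eq]
    have h1 : HasFDerivAt m ((ContinuousLinearMap.toSpanSingleton ℂ (deriv m z)).restrictScalars ℝ) z :=
      hm.differentiableAt.hasDerivAt.hasFDerivAt.restrictScalars ℝ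
    have h2 : HasFDerivAt (deriv m)
        ((ContinuousLinearMap.toSpanSingleton ℂ (deriv (deriv m) z)).restrictScalars ℝ) z :=
      hm.deriv.differentiableAt.hasDerivAt.hasFDerivAt.restrictScalars ℝ
    have h3 := (Complex.conjCLE.toContinuousLinearMap.hasFDerivAt (x := m z)).comp z h1
    have h4 := h3.mul (h2.mul_const e)
    have h5 := (Complex.reCLM.hasFDerivAt (x := starRingEnd ℂ (m z) * (deriv m z * e))).comp z h4
    have h6 := h5.const_mul 2
    have h7 : fderiv ℝ (fun w => 2 * (starRingEnd ℂ (m w) * (deriv m w * e)).re) z = _ := h6.fderiv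
    rw [h7]
    simp
    ring
  unfold lapR
  rw [key, key, ← Complex.normSq_eq_norm_sq, Complex.normSq_apply]
  simp
  ring

/-- `|m|² e^v` is subharmonic -/
lemma lap_subharm {m : ℂ → ℂ} {v : ℂ → ℝ} {z : ℂ} (hm : AnalyticAt ℂ m z)
    (hv : ContDiffAt ℝ 2 v z) (hpos : 0 ≤ lapR v z) :
    0 ≤ lapR (fun x => ‖m x‖ ^ 2 * Real.exp (v x)) z := by
  rw [lap_mul (contDiffAt_normSq hm) hv.exp,
    lap_comp hv Real.exp Real.exp _ Real.hasDerivAt_exp (Real.hasDerivAt_exp _), lap_normSq hm,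
    fderiv_normSq hm.differentiableAt, fderiv_normSq hm.differentiableAt,
    fderiv_exp (hv.differentiableAt (by norm_num))]
  rw [← Complex.normSq_eq_norm_sq, Complex.normSq_apply, ← Complex.normSq_eq_norm_sq, Complex.normSq_apply]
  simp
  set a := (m z).re
  set b := (m z).im
  set p := (deriv m z).re
  set q := (deriv m z).im
  set x := fderiv ℝ v z 1
  set y := fderiv ℝ v z I
  set E := Real.exp (v z)
  have hE : 0 < E := Real.exp_pos _
  have : 0 ≤ E * ((p + (a * x + b * y) / 2) ^ 2 + (q + (b * x - a * y) / 2) ^ 2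
    + (a * a + b * b) * lapR v z) :=
    mul_nonneg hE.le (add_nonneg (add_nonneg (sq_nonneg _) (sq_nonneg _))
      (mul_nonneg (add_nonneg (mul_self_nonneg _) (mul_self_nonneg _)) hpos))
  linarith

end helpers

section helpers2

lemma hasDerivAt_maxpow (n : ℕ) (t : ℝ) :
    HasDerivAt (fun t : ℝ => (max t 0) ^ (n + 2)) ((n + 2) * (max t 0) ^ (n + 1)) t := by
  rcases lt_trichotomy t 0 with h | h | h
  · have : (fun t : ℝ => (max t 0) ^ (n + 2)) =ᶠ[nhds t] fun _ => 0 := by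
      filter_upwards [gt_mem_nhds h] with x hx
      rw [max_eq_right (le_of_lt hx)]; simp
    rw [max_eq_right h.le]
    simpa using (hasDerivAt_const t (0 : ℝ)).congr_of_eventuallyEq this
  · subst h
    rw [hasDerivAt_iff_isLittleO_nhds_zero]
    simp only [max_self, zero_add, ne_eq, Nat.add_eq_zero_iff, one_ne_zero, and_false,
      not_false_eq_true, zero_pow, mul_zero, smul_zero, sub_zero, OfNat.ofNat_ne_zero]
    have h1 : (fun h : ℝ => (max h 0) ^ (n + 2)) =O[nhds 0] fun h : ℝ => h ^ (n + 2) := by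
      apply Asymptotics.IsBigO.of_bound 1
      filter_upwards with x
      rw [norm_pow, norm_pow, one_mul]
      gcongr
      rw [Real.norm_eq_abs, Real.norm_eq_abs, abs_of_nonneg (le_max_right _ _)]
      exact max_le (le_abs_self _) (abs_nonneg _)
    refine h1.trans_isLittleO ?_
    simpa using (Asymptotics.isLittleO_pow_pow (𝕜 := ℝ) (show 1 < n + 2 by omega))
  · have : (fun t : ℝ => (max t 0) ^ (n + 2)) =ᶠ[nhds t] fun t => t ^ (n + 2) := by
      filter_upwards [lt_mem_nhds h] with x hx
      rw [max_eq_left (le_of_lt hx)]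
    rw [max_eq_left h.le]
    simpa using (hasDerivAt_pow (n + 2) t).congr_of_eventuallyEq this

lemma contDiff_maxpow : ContDiff ℝ 2 (fun t : ℝ => (max t 0) ^ 3) := by
  rw [show (2 : WithTop ℕ∞) = 1 + 1 by norm_num, contDiff_succ_iff_deriv]
  have d1 : deriv (fun t : ℝ => (max t 0) ^ 3) = fun t => 3 * (max t 0) ^ 2 := by
    ext t
    rw [(hasDerivAt_maxpow 1 t).deriv]; norm_num
  refine ⟨fun t => (hasDerivAt_maxpow 1 t).differentiableAt, by simp, ?_⟩
  rw [d1, contDiff_one_iff_deriv]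
  have d2 : deriv (fun t : ℝ => 3 * (max t 0) ^ 2) = fun t => 3 * (2 * max t 0) := by
    ext t
    rw [((hasDerivAt_maxpow 0 t).const_mul 3).deriv]; norm_num
  refine ⟨fun t => ((hasDerivAt_maxpow 0 t).const_mul 3).differentiableAt, ?_⟩
  rw [d2]; fun_prop

lemma cont_dir {f : ℂ → ℝ} (hf : ContDiff ℝ 2 f) (e : ℂ) :
    ContDiff ℝ 1 (fun w => fderiv ℝ f w e) := by
  have h1 : ContDiff ℝ 1 (fderiv ℝ f) := hf.fderiv_right (by norm_num)
  exact h1.clm_apply contDiff_const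

lemma supp_dir {f : ℂ → ℝ} (hf : HasCompactSupport f) (e : ℂ) :
    HasCompactSupport (fun w => fderiv ℝ f w e) := hf.fderiv_apply (𝕜 := ℝ) e

lemma parts {f g : ℂ → ℝ} (hf : ContDiff ℝ 1 f) (hg : ContDiff ℝ 1 g) (sg : HasCompactSupport g)
    (e : ℂ) : ∫ x, f x * fderiv ℝ g x e = - ∫ x, fderiv ℝ f x e * g x := by
  have cf := hf.continuous
  have cg := hg.continuous
  have cf' : Continuous (fun x => fderiv ℝ f x e) :=
    (hf.continuous_fderiv (by norm_num)).clm_apply continuous_const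
  have cg' : Continuous (fun x => fderiv ℝ g x e) :=
    (hg.continuous_fderiv (by norm_num)).clm_apply continuous_const
  apply integral_mul_fderiv_eq_neg_fderiv_mul_of_integrable
  · exact (cf'.mul cg).integrable_of_hasCompactSupport sg.mul_left
  · exact (cf.mul cg').integrable_of_hasCompactSupport (supp_dir sg e).mul_left
  · exact (cf.mul cg).integrable_of_hasCompactSupport sg.mul_left
  · exact fun x _ => hf.differentiable (by norm_num) x
  · exact fun x _ => hg.differentiable (by norm_num) x

lemma green_dir {U G : ℂ → ℝ} (hU : ContDiff ℝ 2 U) (hG : ContDiff ℝ 2 G)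
    (sG : HasCompactSupport G) (e : ℂ) :
    ∫ x, U x * fderiv ℝ (fun w => fderiv ℝ G w e) x e =
      ∫ x, fderiv ℝ (fun w => fderiv ℝ U w e) x e * G x := by
  rw [parts (hU.of_le (by norm_num)) (cont_dir hG e) (supp_dir sG e) e,
    parts (cont_dir hU e) (hG.of_le (by norm_num)) sG e, neg_neg]

lemma green_s1 {U G : ℂ → ℝ} (hU : ContDiff ℝ 2 U) (hG : ContDiff ℝ 2 G)
    (sG : HasCompactSupport G) :
    ∫ x, U x * lapR G x = ∫ x, lapR U x * G x := by
  have c2 : ∀ (F : ℂ → ℝ) (_ : ContDiff ℝ 2 F) (e : ℂ),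
      Continuous (fun x => fderiv ℝ (fun w => fderiv ℝ F w e) x e) := fun F hF e =>
    ((cont_dir hF e).continuous_fderiv (by norm_num)).clm_apply continuous_const
  have i1 : ∀ e : ℂ, Integrable (fun x => U x * fderiv ℝ (fun w => fderiv ℝ G w e) x e) := fun e =>
    (hU.continuous.mul (c2 G hG e)).integrable_of_hasCompactSupport
      (supp_dir (supp_dir sG e) e).mul_left
  have i2 : ∀ e : ℂ, Integrable (fun x => fderiv ℝ (fun w => fderiv ℝ U w e) x e * G x) := fun e =>
    ((c2 U hU e).mul hG.continuous).integrable_of_hasCompactSupport sG.mul_left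
  have e1 : (fun x => U x * lapR G x) = fun x =>
      (1/4) * (U x * fderiv ℝ (fun w => fderiv ℝ G w 1) x 1
        + U x * fderiv ℝ (fun w => fderiv ℝ G w I) x I) := by
    ext x; unfold lapR; ring
  have e2 : (fun x => lapR U x * G x) = fun x =>
      (1/4) * (fderiv ℝ (fun w => fderiv ℝ U w 1) x 1 * G x
        + fderiv ℝ (fun w => fderiv ℝ U w I) x I * G x) := by
    ext x; unfold lapR; ring
  rw [e1, e2, integral_const_mul, integral_const_mul, integral_add (i1 1) (i1 I),
    integral_add (i2 1) (i2 I), green_dir hU hG sG, green_dir hU hG sG]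

/-- Laplacian of `(R-|z|²)^(n+2) |p|²`. -/
lemma lap_spow {p : ℂ → ℂ} {z : ℂ} (hp : AnalyticAt ℂ p z) (R : ℝ) (n : ℕ) :
    lapR (fun x => (R - ‖x‖ ^ 2) ^ (n + 2) * ‖p x‖ ^ 2) z =
      (R - ‖z‖ ^ 2) ^ n * ((R - ‖z‖ ^ 2) ^ 2 * ‖deriv p z‖ ^ 2
        + ‖p z‖ ^ 2 * (- (n + 2) * (R - ‖z‖ ^ 2) + (n + 2) * (n + 1) * ‖z‖ ^ 2)
        - 2 * (n + 2) * (R - ‖z‖ ^ 2) * (z * deriv p z * starRingEnd ℂ (p z)).re) := by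
  have hid : AnalyticAt ℂ (fun x : ℂ => x) z := analyticAt_id
  have c1 := contDiffAt_normSq hid
  have cφ : ContDiff ℝ 2 (fun t : ℝ => (R - t) ^ (n + 2)) := by fun_prop
  have d1 : ∀ t : ℝ, HasDerivAt (fun t : ℝ => (R - t) ^ (n + 2)) (-(n + 2) * (R - t) ^ (n + 1)) t := by
    intro t
    refine (((hasDerivAt_id' t).const_sub R).fun_pow (n + 2)).congr_deriv ?_
    push_cast
    ring
  have d2 : ∀ t : ℝ, HasDerivAt (fun t : ℝ => -(n + 2) * (R - t) ^ (n + 1))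
      ((n + 2) * (n + 1) * (R - t) ^ n) t := by
    intro t
    refine ((((hasDerivAt_id' t).const_sub R).fun_pow (n + 1)).const_mul (-((n : ℝ) + 2))).congr_deriv ?_
    push_cast
    ring
  have c2 : ContDiffAt ℝ 2 (fun x : ℂ => (R - ‖x‖ ^ 2) ^ (n + 2)) z :=
    cφ.contDiffAt.comp z c1
  have f1 : ∀ e : ℂ, fderiv ℝ (fun x : ℂ => (R - ‖x‖ ^ 2) ^ (n + 2)) z e =
      -(n + 2) * (R - ‖z‖ ^ 2) ^ (n + 1) * fderiv ℝ (fun x : ℂ => ‖x‖ ^ 2) z e := by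
    intro e
    have := (d1 (‖z‖ ^ 2)).comp_hasFDerivAt z (c1.differentiableAt (by norm_num)).hasFDerivAt
    have h : fderiv ℝ (fun x : ℂ => (R - ‖x‖ ^ 2) ^ (n + 2)) z = _ := this.fderiv
    rw [h]; simp
  rw [lap_mul c2 (contDiffAt_normSq hp),
    lap_comp c1 (fun t : ℝ => (R - t) ^ (n + 2)) _ _ d1 (d2 _), lap_normSq hp, lap_normSq hid,
    f1, f1, fderiv_normSq hid.differentiableAt, fderiv_normSq hid.differentiableAt,
    fderiv_normSq hp.differentiableAt, fderiv_normSq hp.differentiableAt]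
  have e0 : ‖z‖ ^ 2 = z.re * z.re + z.im * z.im := by
    rw [← Complex.normSq_eq_norm_sq, Complex.normSq_apply]
  have hd : deriv (fun x : ℂ => x) z = 1 := by simp
  rw [hd]
  set S := R - ‖z‖ ^ 2
  simp only [e0]
  simp
  ring

lemma int_inv (z0 : ℂ) (C : ℝ) : IntegrableOn (fun z : ℂ => C / ‖z0 - z‖) unitDisk := by
  have h0 : LocallyIntegrable (fun z : ℂ => C / ‖z‖) volume := by
    apply locallyIntegrable_of_norm_le_rpow (C := |C|) (α := 1)
    · simp
    · filter_upwards with x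
      rw [Real.rpow_neg_one]; simp [div_eq_mul_inv]
    · exact (measurable_const.div measurable_norm).aestronglyMeasurable
    · simp
  have h1 : IntegrableOn (fun z : ℂ => C / ‖z‖) ((fun z => z0 - z) '' (closedBall 0 1)) volume :=
    h0.integrableOn_isCompact ((isCompact_closedBall 0 1).image (by fun_prop))
  have mp : MeasurePreserving (fun z : ℂ => z0 - z) volume volume :=
    Measure.measurePreserving_sub_left volume z0
  have me : MeasurableEmbedding (fun z : ℂ => z0 - z) :=
    (Homeomorph.subLeft z0).measurableEmbedding
  have h2 := (mp.integrableOn_image me).1 h1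
  exact h2.mono_set ball_subset_closedBall

end helpers2
set_option maxHeartbeats 4000000 in
lemma alg (Z Zb W Wb T : ℂ) (hD : 1 - Wb * Z ≠ 0) (hDb : 1 - W * Zb ≠ 0) (hB : T - Z ≠ 0) (hT : T ≠ 0)
  (hBb : 1 - T * Zb ≠ 0) (hc : 1 - W * Wb ≠ 0) :
  (1/2) * ((1 - W*Wb) * ((T-W)*(T⁻¹-Wb))) * ((1-Z*Zb) * ((1-Z*Zb)^2 * (1/((1-Wb*Z)^2*(1-W*Zb)^2*(T-Z)*(T⁻¹-Zb))) * ((2*Wb/(1-Wb*Z)+1/(T-Z))*(2*W/(1-W*Zb)+1/(T⁻¹-Zb)))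
    + (1/((1-Wb*Z)^2*(1-W*Zb)^2*(T-Z)*(T⁻¹-Zb)))*(-3*(1-Z*Zb)+6*(Z*Zb)) - 3*(1-Z*Zb)*(1/((1-Wb*Z)^2*(1-W*Zb)^2*(T-Z)*(T⁻¹-Zb)))*(Z*(2*Wb/(1-Wb*Z)+1/(T-Z))+Zb*(2*W/(1-W*Zb)+1/(T⁻¹-Zb)))))
  + (1/4) * ((T-W)*(T⁻¹-Wb))^2*((1-Z*Zb)^2 * ((1-Z*Zb)^2 * (1/((1-Wb*Z)^2*(1-W*Zb)^2*(T-Z)^2*(T⁻¹-Zb)^2)) * ((2*Wb/(1-Wb*Z)+2/(T-Z))*(2*W/(1-W*Zb)+2/(T⁻¹-Zb)))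
    + (1/((1-Wb*Z)^2*(1-W*Zb)^2*(T-Z)^2*(T⁻¹-Zb)^2))*(-4*(1-Z*Zb)+12*(Z*Zb)) - 4*(1-Z*Zb)*(1/((1-Wb*Z)^2*(1-W*Zb)^2*(T-Z)^2*(T⁻¹-Zb)^2))*(Z*(2*Wb/(1-Wb*Z)+2/(T-Z))+Zb*(2*W/(1-W*Zb)+2/(T⁻¹-Zb)))))
  = (1-W*Wb)^3 * (1-Z*Zb) * (1 - ((1-Wb*Z)*(T-W)/((1-W*Wb)*(T-Z)))^3 - ((1-W*Zb)*(T⁻¹-Wb)/((1-W*Wb)*(T⁻¹-Zb)))^3)/((1-Wb*Z)*(1-W*Zb))^3 := by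
  have hBb' : T⁻¹ - Zb = (1 - T*Zb)/T := by field_simp
  have hWb' : T⁻¹ - Wb = (1 - T*Wb)/T := by field_simp
  rw [hBb', hWb']
  field_simp
  ring

section helpers3

def pp (w z0 z : ℂ) : ℂ := ((1 - starRingEnd ℂ w * z) ^ 2 * (z0 - z))⁻¹
def qq (w z0 z : ℂ) : ℂ := ((1 - starRingEnd ℂ w * z) ^ 2 * (z0 - z) ^ 2)⁻¹
def pA (w z0 z : ℂ) : ℂ := 2 * starRingEnd ℂ w / (1 - starRingEnd ℂ w * z) + 1 / (z0 - z)
def qA (w z0 z : ℂ) : ℂ := 2 * starRingEnd ℂ w / (1 - starRingEnd ℂ w * z) + 2 / (z0 - z)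
def XX (w z0 z : ℂ) : ℂ :=
  (1 - starRingEnd ℂ w * z) * (z0 - w) / ((1 - w * starRingEnd ℂ w) * (z0 - z))

def LL (w z0 : ℂ) (R : ℝ) (z : ℂ) : ℝ :=
  (1/2) * ((1 - ‖w‖ ^ 2) * ‖z0 - w‖ ^ 2) * ((R - ‖z‖ ^ 2) * ((R - ‖z‖ ^ 2) ^ 2 * ‖pp w z0 z * pA w z0 z‖ ^ 2
    + ‖pp w z0 z‖ ^ 2 * (- 3 * (R - ‖z‖ ^ 2) + 6 * ‖z‖ ^ 2)
    - 6 * (R - ‖z‖ ^ 2) * (z * (pp w z0 z * pA w z0 z) * starRingEnd ℂ (pp w z0 z)).re))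
  + (1/4) * (‖z0 - w‖ ^ 2) ^ 2 * ((R - ‖z‖ ^ 2) ^ 2 * ((R - ‖z‖ ^ 2) ^ 2 * ‖qq w z0 z * qA w z0 z‖ ^ 2
    + ‖qq w z0 z‖ ^ 2 * (- 4 * (R - ‖z‖ ^ 2) + 12 * ‖z‖ ^ 2)
    - 8 * (R - ‖z‖ ^ 2) * (z * (qq w z0 z * qA w z0 z) * starRingEnd ℂ (qq w z0 z)).re))

lemma d_ne {w z : ℂ} (hw : ‖w‖ < 1) (hz : ‖z‖ < 1) : 1 - starRingEnd ℂ w * z ≠ 0 := by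
  intro h
  have h1 : starRingEnd ℂ w * z = 1 := (sub_eq_zero.1 h).symm
  have h2 : ‖w‖ * ‖z‖ = 1 := by
    have := congrArg norm h1; simpa using this
  nlinarith [norm_nonneg w, norm_nonneg z]

lemma b_ne {z0 z : ℂ} (h0 : ‖z0‖ = 1) (hz : ‖z‖ < 1) : z0 - z ≠ 0 := by
  intro h
  rw [sub_eq_zero.1 h] at h0; linarith

lemma sq_norm_conj (x : ℂ) : ((‖x‖ : ℂ)) ^ 2 = x * starRingEnd ℂ x := (Complex.mul_conj' x).symm

set_option maxRecDepth 20000 in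
lemma LL_one {w z0 z : ℂ} (hw : ‖w‖ < 1) (h0 : ‖z0‖ = 1) (hz : ‖z‖ < 1) :
    LL w z0 1 z = (1 - ‖w‖ ^ 2) ^ 3 * (1 - ‖z‖ ^ 2) * (1 - 2 * XX w z0 z ^ 3).re
      / ‖1 - starRingEnd ℂ w * z‖ ^ 6 := by
  have hT : z0 ≠ 0 := by intro h; simp [h] at h0
  have hTb : starRingEnd ℂ z0 = z0⁻¹ := by
    apply eq_inv_of_mul_eq_one_right
    rw [Complex.mul_conj', h0]; simp
  have hB := b_ne h0 hz
  have hD := d_ne hw hz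
  have hDb : 1 - w * starRingEnd ℂ z ≠ 0 := by
    have := (map_ne_zero (starRingEnd ℂ)).2 hD
    simpa using this
  have hBb : 1 - z0 * starRingEnd ℂ z ≠ 0 := by
    intro h
    apply hB
    have h2 := congrArg (starRingEnd ℂ) h
    simp [hTb] at h2
    field_simp at h2
    simpa using h2
  have hc : 1 - w * starRingEnd ℂ w ≠ 0 := by
    rw [Complex.mul_conj']; norm_cast
    nlinarith [norm_nonneg w]
  have key := alg z (starRingEnd ℂ z) w (starRingEnd ℂ w) z0 hD hDb hB hT hBb hc
  apply Complex.ofReal_injective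
  unfold LL
  push_cast
  rw [show (‖1 - starRingEnd ℂ w * z‖ : ℂ) ^ 6 = ((‖1 - starRingEnd ℂ w * z‖ : ℂ) ^ 2) ^ 3 by ring]
  simp only [Complex.re_eq_add_conj]
  simp only [sq_norm_conj]
  have h2 : starRingEnd ℂ (2 : ℂ) = 2 := Complex.conj_ofNat 2
  simp only [pp, qq, pA, qA, XX]
  simp only [map_mul, map_sub, map_add, map_pow, map_one, Complex.conj_conj, map_inv₀, map_div₀, hTb, h2, inv_inv]
  simp only [one_div, mul_inv, inv_inv] at key ⊢
  linear_combination key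

lemma pp_an {w z0 z : ℂ} (hw : ‖w‖ < 1) (h0 : ‖z0‖ = 1) (hz : ‖z‖ < 1) :
    AnalyticAt ℂ (pp w z0) z := by
  unfold pp
  apply AnalyticAt.fun_inv
  · fun_prop
  · exact mul_ne_zero (pow_ne_zero _ (d_ne hw hz)) (b_ne h0 hz)

lemma qq_an {w z0 z : ℂ} (hw : ‖w‖ < 1) (h0 : ‖z0‖ = 1) (hz : ‖z‖ < 1) :
    AnalyticAt ℂ (qq w z0) z := by
  unfold qq
  apply AnalyticAt.fun_inv
  · fun_prop
  · exact mul_ne_zero (pow_ne_zero _ (d_ne hw hz)) (pow_ne_zero _ (b_ne h0 hz))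

lemma pp_deriv {w z0 z : ℂ} (hw : ‖w‖ < 1) (h0 : ‖z0‖ = 1) (hz : ‖z‖ < 1) :
    deriv (pp w z0) z = pp w z0 z * pA w z0 z := by
  have hD := d_ne hw hz
  have hB := b_ne h0 hz
  have h1 : HasDerivAt (fun z => 1 - starRingEnd ℂ w * z) (-(starRingEnd ℂ w)) z := by
    simpa using ((hasDerivAt_id' z).const_mul (starRingEnd ℂ w)).const_sub 1
  have h2 : HasDerivAt (fun z => z0 - z) (-1) z := (hasDerivAt_id' z).const_sub z0
  have h3 := ((h1.fun_pow 2).fun_mul h2).fun_inv (mul_ne_zero (pow_ne_zero _ hD) hB)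
  have h4 : deriv (pp w z0) z = _ := h3.deriv
  rw [h4]
  unfold pp pA
  field_simp
  ring

lemma qq_deriv {w z0 z : ℂ} (hw : ‖w‖ < 1) (h0 : ‖z0‖ = 1) (hz : ‖z‖ < 1) :
    deriv (qq w z0) z = qq w z0 z * qA w z0 z := by
  have hD := d_ne hw hz
  have hB := b_ne h0 hz
  have h1 : HasDerivAt (fun z => 1 - starRingEnd ℂ w * z) (-(starRingEnd ℂ w)) z := by
    simpa using ((hasDerivAt_id' z).const_mul (starRingEnd ℂ w)).const_sub 1
  have h2 : HasDerivAt (fun z => z0 - z) (-1) z := (hasDerivAt_id' z).const_sub z0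
  have h3 := ((h1.fun_pow 2).fun_mul (h2.fun_pow 2)).fun_inv
    (mul_ne_zero (pow_ne_zero _ hD) (pow_ne_zero _ hB))
  have h4 : deriv (qq w z0) z = _ := h3.deriv
  rw [h4]
  unfold qq qA
  field_simp
  ring

lemma LL_bound_aux (c e S x N M t : ℝ) (P P1 Q Q1 r1 r2 : ℝ)
    (hc0 : 0 ≤ c) (hc : c ≤ 1) (he0 : 0 ≤ e) (he : e ≤ 4) (hS0 : 0 ≤ S) (hS1 : S ≤ 1)
    (hSt : S ≤ 2 * t)
    (hx0 : 0 ≤ x) (hx : x ≤ 1) (hN : 0 ≤ N) (hM : 0 ≤ M) (ht : 0 < t) (ht2 : t ≤ 2)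
    (hP0 : 0 ≤ P) (hP : P ≤ N / t) (hP10 : 0 ≤ P1) (hP1 : P1 ≤ N * M / t ^ 2)
    (hQ0 : 0 ≤ Q) (hQ : Q ≤ N / t ^ 2) (hQ10 : 0 ≤ Q1) (hQ1 : Q1 ≤ N * M / t ^ 3)
    (hr1 : |r1| ≤ P * P1) (hr2 : |r2| ≤ Q * Q1) :
    |(1/2) * (c * e) * (S * (S ^ 2 * P1 ^ 2 + P ^ 2 * (-3 * S + 6 * x) - 6 * S * r1))
      + (1/4) * e ^ 2 * (S ^ 2 * (S ^ 2 * Q1 ^ 2 + Q ^ 2 * (-4 * S + 12 * x) - 8 * S * r2))|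
    ≤ (4 * N ^ 2 * (4 * M ^ 2 + 9 + 12 * M) + 8 * N ^ 2 * (4 * M ^ 2 + 16 + 16 * M)) * S / t ^ 3 := by
  have a1 : |S ^ 2 * P1 ^ 2 + P ^ 2 * (-3 * S + 6 * x) - 6 * S * r1| ≤
      (N ^ 2 * (4 * M ^ 2 + 9 + 12 * M)) / t ^ 2 := by
    have b1 : |S ^ 2 * P1 ^ 2| ≤ (2 * t) ^ 2 * (N * M / t ^ 2) ^ 2 := by
      rw [abs_of_nonneg (by positivity)]; gcongr
    have b2 : |P ^ 2 * (-3 * S + 6 * x)| ≤ (N / t) ^ 2 * 9 := by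
      rw [abs_mul, abs_of_nonneg (sq_nonneg P)]
      have : |-3 * S + 6 * x| ≤ 9 := by rw [abs_le]; constructor <;> linarith
      gcongr
    have b3 : |6 * S * r1| ≤ 6 * (2 * t) * ((N / t) * (N * M / t ^ 2)) := by
      rw [abs_mul, abs_of_nonneg (by positivity)]
      have := hr1.trans (mul_le_mul hP hP1 hP10 (by positivity))
      gcongr
    calc _ ≤ |S ^ 2 * P1 ^ 2| + |P ^ 2 * (-3 * S + 6 * x)| + |6 * S * r1| :=
          (abs_sub _ _).trans (add_le_add_left (abs_add_le _ _) _)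
      _ ≤ (2 * t) ^ 2 * (N * M / t ^ 2) ^ 2 + (N / t) ^ 2 * 9 + 6 * (2 * t) * ((N / t) * (N * M / t ^ 2)) := by
          gcongr
      _ = _ := by field_simp; ring
  have a2 : |S ^ 2 * Q1 ^ 2 + Q ^ 2 * (-4 * S + 12 * x) - 8 * S * r2| ≤
      (N ^ 2 * (4 * M ^ 2 + 16 + 16 * M)) / t ^ 4 := by
    have b1 : |S ^ 2 * Q1 ^ 2| ≤ (2 * t) ^ 2 * (N * M / t ^ 3) ^ 2 := by
      rw [abs_of_nonneg (by positivity)]; gcongr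
    have b2 : |Q ^ 2 * (-4 * S + 12 * x)| ≤ (N / t ^ 2) ^ 2 * 16 := by
      rw [abs_mul, abs_of_nonneg (sq_nonneg Q)]
      have : |-4 * S + 12 * x| ≤ 16 := by rw [abs_le]; constructor <;> linarith
      gcongr
    have b3 : |8 * S * r2| ≤ 8 * (2 * t) * ((N / t ^ 2) * (N * M / t ^ 3)) := by
      rw [abs_mul, abs_of_nonneg (by positivity)]
      have := hr2.trans (mul_le_mul hQ hQ1 hQ10 (by positivity))
      gcongr
    calc _ ≤ |S ^ 2 * Q1 ^ 2| + |Q ^ 2 * (-4 * S + 12 * x)| + |8 * S * r2| :=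
          (abs_sub _ _).trans (add_le_add_left (abs_add_le _ _) _)
      _ ≤ (2 * t) ^ 2 * (N * M / t ^ 3) ^ 2 + (N / t ^ 2) ^ 2 * 16 + 8 * (2 * t) * ((N / t ^ 2) * (N * M / t ^ 3)) := by
          gcongr
      _ = _ := by field_simp; ring
  refine (abs_add_le _ _).trans ?_
  have k1 : |(1/2) * (c * e) * (S * (S ^ 2 * P1 ^ 2 + P ^ 2 * (-3 * S + 6 * x) - 6 * S * r1))| ≤
      (1/2) * (1 * 4) * (S * ((N ^ 2 * (4 * M ^ 2 + 9 + 12 * M)) / t ^ 2)) := by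
    rw [abs_mul, abs_mul S, abs_of_nonneg hS0, abs_of_nonneg (by positivity)]
    gcongr
  have k2 : |(1/4) * e ^ 2 * (S ^ 2 * (S ^ 2 * Q1 ^ 2 + Q ^ 2 * (-4 * S + 12 * x) - 8 * S * r2))| ≤
      (1/4) * 4 ^ 2 * ((S * (2 * t)) * ((N ^ 2 * (4 * M ^ 2 + 16 + 16 * M)) / t ^ 4)) := by
    rw [abs_mul, abs_mul (S ^ 2), abs_of_nonneg (sq_nonneg S), abs_of_nonneg (by positivity)]
    have : S ^ 2 ≤ S * (2 * t) := by nlinarith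
    gcongr
  have k3 : (1/2) * (1 * 4) * (S * ((N ^ 2 * (4 * M ^ 2 + 9 + 12 * M)) / t ^ 2)) ≤
      (4 * N ^ 2 * (4 * M ^ 2 + 9 + 12 * M)) * S / t ^ 3 := by
    rw [show (1/2) * (1 * 4) * (S * ((N ^ 2 * (4 * M ^ 2 + 9 + 12 * M)) / t ^ 2)) =
      ((2 * N ^ 2 * (4 * M ^ 2 + 9 + 12 * M)) * S * t) / t ^ 3 by field_simp; ring]
    apply div_le_div_of_nonneg_right _ (by positivity)
    have : 0 ≤ (2 * N ^ 2 * (4 * M ^ 2 + 9 + 12 * M)) * S := by positivity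
    nlinarith
  have k4 : (1/4) * 4 ^ 2 * ((S * (2 * t)) * ((N ^ 2 * (4 * M ^ 2 + 16 + 16 * M)) / t ^ 4)) =
      8 * N ^ 2 * (4 * M ^ 2 + 16 + 16 * M) * S / t ^ 3 := by
    field_simp; ring
  calc _ ≤ _ := add_le_add (k1.trans k3) (k2.trans k4.le)
    _ = _ := by ring

lemma s_le {z0 z : ℂ} (h0 : ‖z0‖ = 1) (hz : ‖z‖ < 1) : 1 - ‖z‖ ^ 2 ≤ 2 * ‖z0 - z‖ := by
  have h1 : ‖z0‖ - ‖z‖ ≤ ‖z0 - z‖ := norm_sub_norm_le _ _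
  nlinarith [norm_nonneg z]

lemma LL_bound {w z0 : ℂ} (hw : ‖w‖ < 1) (h0 : ‖z0‖ = 1) :
    ∃ C : ℝ, 0 ≤ C ∧ ∀ (z : ℂ) (R : ℝ), ‖z‖ < 1 → ‖z‖ ^ 2 ≤ R → R ≤ 1 →
      |LL w z0 R z| ≤ C * (1 - ‖z‖ ^ 2) / ‖z0 - z‖ ^ 3 := by
  set δ := 1 - ‖w‖ with hδ
  have hδ0 : 0 < δ := by linarith
  set N := 1 / δ ^ 2
  set M := 4 / δ + 2 with hMdef
  have hN : 0 ≤ N := by positivity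
  have hM : 0 ≤ M := by positivity
  refine ⟨4 * N ^ 2 * (4 * M ^ 2 + 9 + 12 * M) + 8 * N ^ 2 * (4 * M ^ 2 + 16 + 16 * M),
    by positivity, ?_⟩
  intro z R hz hR hR1
  set t := ‖z0 - z‖ with htdef
  have ht : 0 < t := norm_pos_iff.2 (b_ne h0 hz)
  have ht2 : t ≤ 2 := by
    have := norm_sub_le z0 z; linarith
  have hd : δ ≤ ‖1 - starRingEnd ℂ w * z‖ := by
    have h1 : ‖(1 : ℂ)‖ - ‖starRingEnd ℂ w * z‖ ≤ _ := norm_sub_norm_le _ _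
    have h2 : ‖starRingEnd ℂ w * z‖ ≤ ‖w‖ := by
      rw [norm_mul, RCLike.norm_conj]; nlinarith [norm_nonneg w]
    rw [norm_one] at h1; linarith
  have hd0 : 0 < ‖1 - starRingEnd ℂ w * z‖ := by linarith
  have hP : ‖pp w z0 z‖ ≤ N / t := by
    unfold pp
    rw [norm_inv, norm_mul, norm_pow, ← htdef, ← one_div, div_div]
    gcongr
  have hQ : ‖qq w z0 z‖ ≤ N / t ^ 2 := by
    unfold qq
    rw [norm_inv, norm_mul, norm_pow, norm_pow, ← htdef, ← one_div, div_div]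
    gcongr
  have hW : ‖2 * starRingEnd ℂ w / (1 - starRingEnd ℂ w * z)‖ ≤ (4 / δ) / t := by
    have : ‖2 * starRingEnd ℂ w / (1 - starRingEnd ℂ w * z)‖ ≤ 2 * 1 / δ := by
      rw [norm_div, norm_mul, RCLike.norm_conj]
      have : ‖(2 : ℂ)‖ = 2 := by simp
      rw [this]
      gcongr
    refine this.trans ?_
    rw [div_div, div_le_div_iff₀ hδ0 (by positivity)]
    nlinarith
  have hpA : ‖pA w z0 z‖ ≤ M / t := by
    unfold pA
    refine (norm_add_le _ _).trans ?_
    have : ‖1 / (z0 - z)‖ = 1 / t := by rw [norm_div, norm_one]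
    rw [this, hMdef, add_div]
    have : 1 / t ≤ 2 / t := by gcongr; norm_num
    linarith
  have hqA : ‖qA w z0 z‖ ≤ M / t := by
    unfold qA
    refine (norm_add_le _ _).trans ?_
    have : ‖2 / (z0 - z)‖ = 2 / t := by rw [norm_div]; simp [htdef]
    rw [this, hMdef, add_div]
    linarith
  have hP1 : ‖pp w z0 z * pA w z0 z‖ ≤ N * M / t ^ 2 := by
    rw [norm_mul]
    calc _ ≤ (N / t) * (M / t) := by gcongr
      _ = _ := by field_simp
  have hQ1 : ‖qq w z0 z * qA w z0 z‖ ≤ N * M / t ^ 3 := by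
    rw [norm_mul]
    calc _ ≤ (N / t ^ 2) * (M / t) := by gcongr
      _ = _ := by field_simp
  have hr : ∀ a b : ℂ, |(z * a * starRingEnd ℂ b).re| ≤ ‖b‖ * ‖a‖ := by
    intro a b
    refine (Complex.abs_re_le_norm _).trans ?_
    rw [norm_mul, norm_mul, RCLike.norm_conj]
    have : ‖z‖ * ‖a‖ ≤ 1 * ‖a‖ := by gcongr
    nlinarith [norm_nonneg a, norm_nonneg b]
  have hs := s_le h0 hz
  have hz2 : ‖z‖ ^ 2 ≤ 1 := by nlinarith [norm_nonneg z]
  have hw2 : ‖w‖ ^ 2 ≤ 1 := by nlinarith [norm_nonneg w]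
  have he : ‖z0 - w‖ ^ 2 ≤ 4 := by
    have := norm_sub_le z0 w
    nlinarith [norm_nonneg (z0 - w)]
  have main := LL_bound_aux (1 - ‖w‖ ^ 2) (‖z0 - w‖ ^ 2) (R - ‖z‖ ^ 2) (‖z‖ ^ 2) N M t
    ‖pp w z0 z‖ ‖pp w z0 z * pA w z0 z‖ ‖qq w z0 z‖ ‖qq w z0 z * qA w z0 z‖ _ _
    (by linarith) (by nlinarith [norm_nonneg w]) (by positivity) he
    (by linarith) (by nlinarith [norm_nonneg z]) (by linarith) (by positivity) hz2 hN hM ht ht2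
    (norm_nonneg _) hP (norm_nonneg _) hP1 (norm_nonneg _) hQ (norm_nonneg _) hQ1
    (hr (pp w z0 z * pA w z0 z) (pp w z0 z)) (hr (qq w z0 z * qA w z0 z) (qq w z0 z))
  unfold LL
  refine main.trans ?_
  gcongr

end helpers3

section helpers4

lemma lap_const_mul {f : ℂ → ℝ} {z : ℂ} (A : ℝ) (hf : ContDiffAt ℝ 2 f z) :
    lapR (fun x => A * f x) z = A * lapR f z := by
  rw [lap_mul contDiffAt_const hf]
  simp [lapR]

def GG (w z0 : ℂ) (R : ℝ) (x : ℂ) : ℝ :=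
  (max (R - ‖x‖ ^ 2) 0) ^ 3 * ((1/2) * ((1 - ‖w‖ ^ 2) * ‖z0 - w‖ ^ 2) * ‖pp w z0 x‖ ^ 2
    + (1/4) * (‖z0 - w‖ ^ 2) ^ 2 * (R - ‖x‖ ^ 2) * ‖qq w z0 x‖ ^ 2)

lemma contDiffAt_nsq (R : ℝ) (z : ℂ) : ContDiffAt ℝ 2 (fun x : ℂ => R - ‖x‖ ^ 2) z :=
  contDiffAt_const.sub (contDiffAt_normSq (m := fun x => x) analyticAt_id)

lemma lap_main {w z0 z : ℂ} (R : ℝ) (hw : ‖w‖ < 1) (h0 : ‖z0‖ = 1) (hz : ‖z‖ < 1) :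
    lapR (fun x => (1/2) * ((1 - ‖w‖ ^ 2) * ‖z0 - w‖ ^ 2) * ((R - ‖x‖ ^ 2) ^ (1 + 2) * ‖pp w z0 x‖ ^ 2)
      + (1/4) * (‖z0 - w‖ ^ 2) ^ 2 * ((R - ‖x‖ ^ 2) ^ (2 + 2) * ‖qq w z0 x‖ ^ 2)) z = LL w z0 R z := by
  have c1 : ContDiffAt ℝ 2 (fun x => (R - ‖x‖ ^ 2) ^ (1 + 2) * ‖pp w z0 x‖ ^ 2) z :=
    ((contDiffAt_nsq R z).pow _).mul (contDiffAt_normSq (pp_an hw h0 hz))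
  have c2 : ContDiffAt ℝ 2 (fun x => (R - ‖x‖ ^ 2) ^ (2 + 2) * ‖qq w z0 x‖ ^ 2) z :=
    ((contDiffAt_nsq R z).pow _).mul (contDiffAt_normSq (qq_an hw h0 hz))
  rw [lap_add (contDiffAt_const.mul c1) (contDiffAt_const.mul c2), lap_const_mul _ c1,
    lap_const_mul _ c2, lap_spow (pp_an hw h0 hz), lap_spow (qq_an hw h0 hz), pp_deriv hw h0 hz,
    qq_deriv hw h0 hz]
  unfold LL
  push_cast
  ring

lemma GG_lap_in {w z0 z : ℂ} {r : ℝ} (hw : ‖w‖ < 1) (h0 : ‖z0‖ = 1) (hr1 : r < 1)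
    (hz : ‖z‖ < r) : lapR (GG w z0 (r ^ 2)) z = LL w z0 (r ^ 2) z := by
  rw [← lap_main (r ^ 2) hw h0 (hz.trans hr1)]
  apply lap_congr
  have : ∀ᶠ x in nhds z, ‖x‖ < r := continuous_norm.continuousAt.eventually_lt continuousAt_const hz
  filter_upwards [this] with x hx
  have : 0 ≤ r ^ 2 - ‖x‖ ^ 2 := by nlinarith [norm_nonneg x]
  unfold GG
  rw [max_eq_left this]; ring

lemma GG_out {w z0 z : ℂ} {r : ℝ} (hr0 : 0 < r) (hz : r ≤ ‖z‖) : GG w z0 (r ^ 2) z = 0 := by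
  unfold GG
  rw [max_eq_right (by nlinarith)]; simp

lemma GG_ev_out {w z0 z : ℂ} {r : ℝ} (hr0 : 0 < r) (hz : r < ‖z‖) :
    GG w z0 (r ^ 2) =ᶠ[nhds z] fun _ => 0 := by
  have : ∀ᶠ x in nhds z, r < ‖x‖ := continuousAt_const.eventually_lt continuous_norm.continuousAt hz
  filter_upwards [this] with x hx
  exact GG_out hr0 hx.le

lemma GG_lap_out {w z0 z : ℂ} {r : ℝ} (hr0 : 0 < r) (hz : r < ‖z‖) :
    lapR (GG w z0 (r ^ 2)) z = 0 := by
  rw [lap_congr (GG_ev_out hr0 hz)]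
  simp [lapR]

lemma GG_nonneg {w z0 : ℂ} {r : ℝ} (hw : ‖w‖ < 1) (hr0 : 0 < r) (z : ℂ) :
    0 ≤ GG w z0 (r ^ 2) z := by
  rcases le_or_gt r ‖z‖ with h | h
  · rw [GG_out hr0 h]
  · have : 0 ≤ r ^ 2 - ‖z‖ ^ 2 := by nlinarith [norm_nonneg z]
    have h2 : 0 ≤ 1 - ‖w‖ ^ 2 := by nlinarith [norm_nonneg w]
    unfold GG
    positivity

lemma GG_contDiff {w z0 : ℂ} {r : ℝ} (hw : ‖w‖ < 1) (h0 : ‖z0‖ = 1) (hr0 : 0 < r) (hr1 : r < 1) :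
    ContDiff ℝ 2 (GG w z0 (r ^ 2)) := by
  rw [contDiff_iff_contDiffAt]
  intro z
  rcases lt_or_ge r ‖z‖ with h | h
  · exact contDiffAt_const.congr_of_eventuallyEq (GG_ev_out hr0 h)
  · have hz : ‖z‖ < 1 := by linarith
    unfold GG
    refine ContDiffAt.mul ?_ (ContDiffAt.add ?_ ?_)
    · exact contDiff_maxpow.contDiffAt.comp z (contDiffAt_nsq (r ^ 2) z)
    · exact contDiffAt_const.mul (contDiffAt_normSq (pp_an hw h0 hz))
    · exact (contDiffAt_const.mul (contDiffAt_nsq _ z)).mul (contDiffAt_normSq (qq_an hw h0 hz))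

lemma GG_supp {w z0 : ℂ} {r : ℝ} (hr0 : 0 < r) : HasCompactSupport (GG w z0 (r ^ 2)) := by
  apply HasCompactSupport.intro (isCompact_closedBall (0 : ℂ) r)
  intro x hx
  apply GG_out hr0
  simp at hx; exact hx.le

lemma step3 {w z0 : ℂ} {r : ℝ} (hw : ‖w‖ < 1) (h0 : ‖z0‖ = 1) (hr0 : 0 < r) (hr1 : r < 1)
    (V : ℂ → ℝ) (hV : ∀ z, ‖z‖ < 1 → ContDiffAt ℝ 2 V z) (hL : ∀ z, ‖z‖ < 1 → 0 ≤ lapR V z) :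
    0 ≤ ∫ z in ball (0 : ℂ) r, V z * LL w z0 (r ^ 2) z := by
  let χ : ContDiffBump (0 : ℂ) := ⟨(1 + r) / 2, (3 + r) / 4, by linarith, by linarith⟩
  set U : ℂ → ℝ := fun x => χ x * V x with hU
  have hUV : ∀ z, ‖z‖ ≤ r → U =ᶠ[nhds z] V := by
    intro z hz
    have : ∀ᶠ x in nhds z, ‖x‖ < (1 + r) / 2 :=
      continuous_norm.continuousAt.eventually_lt continuousAt_const (by linarith)
    filter_upwards [this] with x hx
    have : χ x = 1 := χ.one_of_mem_closedBall (by
      rw [mem_closedBall_zero_iff]; exact hx.le)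
    simp [hU, this]
  have cU : ContDiff ℝ 2 U := by
    rw [contDiff_iff_contDiffAt]
    intro z
    rcases lt_or_ge ‖z‖ 1 with h | h
    · exact χ.contDiffAt.mul (hV z h)
    · have : U =ᶠ[nhds z] fun _ => 0 := by
        have : ∀ᶠ x in nhds z, (3 + r) / 4 < ‖x‖ :=
          continuousAt_const.eventually_lt continuous_norm.continuousAt (by linarith)
        filter_upwards [this] with x hx
        have : χ x = 0 := χ.zero_of_le_dist (by rw [dist_zero_right]; exact hx.le)
        simp [hU, this]
      exact contDiffAt_const.congr_of_eventuallyEq this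
  have key := green_s1 cU (GG_contDiff hw h0 hr0 hr1) (GG_supp (w := w) (z0 := z0) hr0)
  have h1 : ∫ z in ball (0 : ℂ) r, V z * LL w z0 (r ^ 2) z = ∫ x, U x * lapR (GG w z0 (r ^ 2)) x := by
    rw [← integral_indicator measurableSet_ball]
    apply integral_congr_ae
    have hs : ∀ᵐ x : ℂ, x ∉ sphere (0 : ℂ) r :=
      measure_eq_zero_iff_ae_notMem.1 (Measure.addHaar_sphere volume 0 r)
    filter_upwards [hs] with x hx
    rw [mem_sphere_zero_iff_norm] at hx
    rcases lt_or_gt_of_ne hx with h | h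
    · rw [indicator_of_mem (by simpa using h), GG_lap_in hw h0 hr1 h, (hUV x h.le).eq_of_nhds]
    · rw [indicator_of_notMem (by simpa using h.le), GG_lap_out hr0 h, mul_zero]
  rw [h1, key]
  apply integral_nonneg
  intro x
  simp only [Pi.zero_apply]
  rcases le_or_gt r ‖x‖ with h | h
  · rw [GG_out hr0 h, mul_zero]
  · rw [lap_congr (hUV x h.le)]
    exact mul_nonneg (hL x (h.trans hr1)) (GG_nonneg hw hr0 x)

end helpers4

section helpers5

lemma lip {k : ℂ → ℂ} (hk : ContDiffOn ℝ 1 k closedDisk) {z0 : ℂ} (h0 : ‖z0‖ = 1) (hz : k z0 = 0) :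
    ∃ C : ℝ, 0 ≤ C ∧ ∀ z, ‖z‖ ≤ 1 → ‖k z‖ ≤ C * ‖z0 - z‖ := by
  have hconv : Convex ℝ closedDisk := convex_closedBall 0 1
  have hu : UniqueDiffOn ℝ closedDisk := by
    apply uniqueDiffOn_convex hconv
    refine ⟨0, ?_⟩
    unfold closedDisk
    exact ball_subset_interior_closedBall (by simp)
  have hc := hk.continuousOn_fderivWithin hu (by norm_num)
  obtain ⟨C, hC⟩ := (isCompact_closedBall (0 : ℂ) 1).exists_bound_of_continuousOn hc
  have hm : z0 ∈ closedDisk := by simp [closedDisk, h0]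
  refine ⟨C, (norm_nonneg _).trans (hC z0 hm), ?_⟩
  intro z hz1
  have := hconv.norm_image_sub_le_of_norm_fderivWithin_le (hk.differentiableOn (by norm_num))
    hC hm (show z ∈ closedDisk by simpa [closedDisk] using hz1)
  rw [hz, sub_zero] at this
  rwa [norm_sub_rev z0 z]

lemma meas_LL (w z0 : ℂ) (R : ℝ) : Measurable (LL w z0 R) := by
  unfold LL pp qq pA qA
  fun_prop

lemma cont_LL (w z0 z : ℂ) : Continuous (fun R => LL w z0 R z) := by
  unfold LL
  fun_prop

lemma stepLower {w z0 : ℂ} (hw : ‖w‖ < 1) (h0 : ‖z0‖ = 1) {ω : ℂ → ℝ} {k : ℂ → ℂ}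
    (hωpos : ∀ z ∈ closedDisk, 0 < ω z)
    (hωsmooth : ContDiffOn ℝ (⊤ : ℕ∞) ω closedDisk)
    (hsub : ∀ z ∈ unitDisk, 0 ≤ lapR (fun z => Real.log (ω z / (1 - ‖z‖ ^ 2))) z)
    (hk : DifferentiableOn ℂ k unitDisk)
    {C M : ℝ} (hC0 : 0 ≤ C) (hC : ∀ z, ‖z‖ ≤ 1 → ‖k z‖ ≤ C * ‖z0 - z‖)
    (hM : ∀ z, ‖z‖ ≤ 1 → ω z ≤ M) :
    0 ≤ ∫ z in unitDisk, ‖k z‖ ^ 2 * ω z * (1 - 2 * XX w z0 z ^ 3).re := by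
  have hmem : ∀ z : ℂ, ‖z‖ < 1 → z ∈ unitDisk := fun z hz => by simpa [unitDisk] using hz
  have hmem' : ∀ z : ℂ, ‖z‖ < 1 → z ∈ closedDisk := fun z hz => by simpa [closedDisk] using hz.le
  set V : ℂ → ℝ := fun z => ‖k z * (1 - starRingEnd ℂ w * z) ^ 3‖ ^ 2
    * Real.exp (Real.log (ω z / (1 - ‖z‖ ^ 2))) with hVdef
  have hs : ∀ z : ℂ, ‖z‖ < 1 → 0 < 1 - ‖z‖ ^ 2 := fun z hz => by nlinarith [norm_nonneg z]
  have hVe : ∀ z : ℂ, ‖z‖ < 1 → V z = ‖k z‖ ^ 2 * ω z * ‖1 - starRingEnd ℂ w * z‖ ^ 6 / (1 - ‖z‖ ^ 2) := by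
    intro z hz
    simp only [hVdef]
    rw [Real.exp_log (div_pos (hωpos z (hmem' z hz)) (hs z hz)), norm_mul, norm_pow]; ring
  have han : ∀ z : ℂ, ‖z‖ < 1 → AnalyticAt ℂ (fun z => k z * (1 - starRingEnd ℂ w * z) ^ 3) z := by
    intro z hz
    have : AnalyticAt ℂ k z := hk.analyticAt (isOpen_ball.mem_nhds (hmem z hz))
    fun_prop
  have hlog : ∀ z : ℂ, ‖z‖ < 1 → ContDiffAt ℝ 2 (fun z => Real.log (ω z / (1 - ‖z‖ ^ 2))) z := by
    intro z hz
    have h1 : ContDiffAt ℝ 2 ω z :=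
      (hωsmooth.contDiffAt (Filter.mem_of_superset (isOpen_ball.mem_nhds (hmem z hz))
        ball_subset_closedBall)).of_le (show ((2 : ℕ∞) : WithTop ℕ∞) ≤ _ from WithTop.coe_le_coe.2 le_top)
    exact (h1.div (contDiffAt_nsq 1 z) (hs z hz).ne').log
      (div_pos (hωpos z (hmem' z hz)) (hs z hz)).ne'
  have hV : ∀ z, ‖z‖ < 1 → ContDiffAt ℝ 2 V z := fun z hz =>
    (contDiffAt_normSq (han z hz)).mul (hlog z hz).exp
  have hL : ∀ z, ‖z‖ < 1 → 0 ≤ lapR V z := fun z hz =>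
    lap_subharm (han z hz) (hlog z hz) (hsub z (hmem z hz))
  obtain ⟨B, hB0, hB⟩ := LL_bound hw h0
  have hM0 : 0 ≤ M := (hωpos 0 (hmem' 0 (by simp))).le.trans (hM 0 (by simp))
  have hbd : ∀ (z : ℂ) (R : ℝ), ‖z‖ < 1 → ‖z‖ ^ 2 ≤ R → R ≤ 1 →
      |V z * LL w z0 R z| ≤ (C ^ 2 * M * 64 * B) / ‖z0 - z‖ := by
    intro z R hz hR hR1
    have ht : 0 < ‖z0 - z‖ := norm_pos_iff.2 (b_ne h0 hz)
    have hd : ‖1 - starRingEnd ℂ w * z‖ ≤ 2 := by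
      refine (norm_sub_le _ _).trans ?_
      rw [norm_mul, RCLike.norm_conj, norm_one]; nlinarith [norm_nonneg w, norm_nonneg z]
    have hss := hs z hz
    have hω0 := hωpos z (hmem' z hz)
    have hVb : |V z| ≤ (C * ‖z0 - z‖) ^ 2 * M * 2 ^ 6 / (1 - ‖z‖ ^ 2) := by
      rw [hVe z hz, abs_of_nonneg (by positivity)]
      have := hC z hz.le
      have := hM z hz.le
      gcongr
    rw [abs_mul]
    calc _ ≤ ((C * ‖z0 - z‖) ^ 2 * M * 2 ^ 6 / (1 - ‖z‖ ^ 2)) * (B * (1 - ‖z‖ ^ 2) / ‖z0 - z‖ ^ 3) := by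
          have := hB z R hz hR hR1
          gcongr
      _ = _ := by field_simp; ring
  have hVm : AEStronglyMeasurable V (volume.restrict unitDisk) := by
    apply ContinuousOn.aestronglyMeasurable _ measurableSet_ball
    intro z hz
    exact (hV z (by simpa [unitDisk] using hz)).continuousAt.continuousWithinAt
  set r : ℕ → ℝ := fun n => 1 - 1 / ((n : ℝ) + 2) with hr
  have hr0 : ∀ n, 0 < r n := by
    intro n
    have : 1 / ((n : ℝ) + 2) < 1 := by rw [div_lt_one (by positivity)]; linarith [Nat.cast_nonneg (α := ℝ) n]
    simp only [hr]; linarith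
  have hr1 : ∀ n, r n < 1 := by
    intro n
    have : 0 < 1 / ((n : ℝ) + 2) := by positivity
    simp only [hr]; linarith
  have hrt : Filter.Tendsto r Filter.atTop (nhds 1) := by
    have h := (tendsto_one_div_add_atTop_nhds_zero_nat (𝕜 := ℝ)).comp (Filter.tendsto_add_atTop_nat 1)
    have h2 := h.const_sub 1
    rw [sub_zero] at h2
    refine h2.congr fun n => ?_
    simp only [hr, Function.comp]; push_cast; ring_nf
  have key := tendsto_integral_of_dominated_convergence (μ := volume.restrict unitDisk)
    (F := fun n => (ball (0 : ℂ) (r n)).indicator (fun z => V z * LL w z0 (r n ^ 2) z))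
    (f := fun z => (1 - ‖w‖ ^ 2) ^ 3 * (‖k z‖ ^ 2 * ω z * (1 - 2 * XX w z0 z ^ 3).re))
    (fun z => (C ^ 2 * M * 64 * B) / ‖z0 - z‖)
    (fun n => (hVm.mul (meas_LL w z0 _).aestronglyMeasurable).indicator measurableSet_ball)
    (int_inv z0 _) ?_ ?_
  · have hnn : 0 ≤ ∫ z in unitDisk, (1 - ‖w‖ ^ 2) ^ 3 * (‖k z‖ ^ 2 * ω z * (1 - 2 * XX w z0 z ^ 3).re) := by
      refine ge_of_tendsto' key fun n => ?_
      rw [setIntegral_indicator measurableSet_ball]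
      have : unitDisk ∩ ball (0 : ℂ) (r n) = ball 0 (r n) :=
        inter_eq_right.2 (ball_subset_ball (hr1 n).le)
      rw [this]
      exact step3 hw h0 (hr0 n) (hr1 n) V hV hL
    rw [integral_const_mul] at hnn
    exact nonneg_of_mul_nonneg_right hnn (pow_pos (hs w hw) 3)
  · intro n
    refine (ae_restrict_iff' measurableSet_ball).2 (Filter.Eventually.of_forall fun z hz => ?_)
    have hz1 : ‖z‖ < 1 := by simpa using hz
    by_cases h : z ∈ ball (0 : ℂ) (r n)
    · rw [indicator_of_mem h, Real.norm_eq_abs]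
      have h' : ‖z‖ < r n := by simpa using h
      have := hr1 n
      have := hr0 n
      exact hbd z _ hz1 (by gcongr) (by nlinarith)
    · rw [indicator_of_notMem h, norm_zero]; positivity
  · refine (ae_restrict_iff' measurableSet_ball).2 (Filter.Eventually.of_forall fun z hz => ?_)
    have hz1 : ‖z‖ < 1 := by simpa using hz
    have hlim : (1 - ‖w‖ ^ 2) ^ 3 * (‖k z‖ ^ 2 * ω z * (1 - 2 * XX w z0 z ^ 3).re)
        = V z * LL w z0 (1 ^ 2) z := by
      rw [one_pow, LL_one hw h0 hz1, hVe z hz1]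
      have := hs z hz1
      have := norm_pos_iff.2 (d_ne hw hz1)
      field_simp
    rw [hlim]
    have h1 : Filter.Tendsto (fun n => V z * LL w z0 (r n ^ 2) z) Filter.atTop
        (nhds (V z * LL w z0 (1 ^ 2) z)) :=
      (((cont_LL w z0 z).tendsto _).comp (hrt.pow 2)).const_mul _
    refine h1.congr' ?_
    filter_upwards [hrt.eventually_const_lt hz1] with n hn
    rw [indicator_of_mem (by simpa using hn)]

end helpers5

section helpers6

def XR (w z0 : ℂ) (ρ : ℝ) (z : ℂ) : ℂ :=
  (1 - starRingEnd ℂ w * z) * (z0 - w) / ((1 - w * starRingEnd ℂ w) * (z0 - ρ * z))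

lemma XR_one (w z0 z : ℂ) : XR w z0 1 z = XX w z0 z := by simp [XR, XX]

lemma c_ne {w : ℂ} (hw : ‖w‖ < 1) : 1 - w * starRingEnd ℂ w ≠ 0 := by
  rw [Complex.mul_conj']; norm_cast
  nlinarith [norm_nonneg w]

lemma XX_w {w z0 : ℂ} (hw : ‖w‖ < 1) (h0 : ‖z0‖ = 1) : XX w z0 w = 1 := by
  unfold XX
  rw [mul_comm (starRingEnd ℂ w) w]
  exact div_self (mul_ne_zero (c_ne hw) (b_ne h0 hw))

lemma half_le {z0 z : ℂ} {ρ : ℝ} (h0 : ‖z0‖ = 1) (hz : ‖z‖ ≤ 1) (hρ0 : 0 ≤ ρ) (hρ1 : ρ ≤ 1) :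
    ‖z0 - z‖ ≤ 2 * ‖z0 - ρ * z‖ := by
  have h1 : ‖z0 - z‖ ≤ ‖z0 - ρ * z‖ + (1 - ρ) * ‖z‖ := by
    calc ‖z0 - z‖ = ‖(z0 - ρ * z) - ((1 - ρ : ℝ) : ℂ) * z‖ := by congr 1; push_cast; ring
      _ ≤ _ := norm_sub_le _ _
      _ = _ := by rw [norm_mul, Complex.norm_real, Real.norm_of_nonneg (by linarith)]
  have h2 : ‖z0‖ - ‖(ρ : ℂ) * z‖ ≤ ‖z0 - ρ * z‖ := norm_sub_norm_le _ _
  rw [norm_mul, Complex.norm_real, Real.norm_of_nonneg hρ0, h0] at h2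
  nlinarith [norm_nonneg z]

lemma g_bound {w z0 z : ℂ} {ρ : ℝ} (hw : ‖w‖ < 1) (h0 : ‖z0‖ = 1) (hz : ‖z‖ < 1)
    (hρ0 : 0 ≤ ρ) (hρ1 : ρ ≤ 1) :
    ‖1 - 2 * XR w z0 ρ z ^ 3‖ ≤ (8 + 2 * (8 / (1 - ‖w‖ ^ 2)) ^ 3) / ‖z0 - z‖ ^ 3 := by
  have ht : 0 < ‖z0 - z‖ := norm_pos_iff.2 (b_ne h0 hz)
  have ht2 : ‖z0 - z‖ ≤ 2 := by
    have := norm_sub_le z0 z; linarith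
  have hd : ‖1 - starRingEnd ℂ w * z‖ ≤ 2 := by
    refine (norm_sub_le _ _).trans ?_
    rw [norm_mul, RCLike.norm_conj, norm_one]; nlinarith [norm_nonneg w, norm_nonneg z]
  have he : ‖z0 - w‖ ≤ 2 := by
    have := norm_sub_le z0 w; linarith
  have hc0 : 0 < 1 - ‖w‖ ^ 2 := by nlinarith [norm_nonneg w]
  have hc : ‖1 - w * starRingEnd ℂ w‖ = 1 - ‖w‖ ^ 2 := by
    rw [Complex.mul_conj', show (1 : ℂ) - (‖w‖ : ℂ) ^ 2 = ((1 - ‖w‖ ^ 2 : ℝ) : ℂ) by push_cast; ring,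
      Complex.norm_real, Real.norm_of_nonneg hc0.le]
  have hh := half_le (ρ := ρ) h0 hz.le hρ0 hρ1
  have hX : ‖XR w z0 ρ z‖ ≤ (8 / (1 - ‖w‖ ^ 2)) / ‖z0 - z‖ := by
    unfold XR
    rw [norm_div, norm_mul, norm_mul, hc]
    calc _ ≤ 2 * 2 / ((1 - ‖w‖ ^ 2) * (‖z0 - z‖ / 2)) := by
          gcongr
          linarith
      _ = _ := by field_simp; norm_num
  calc _ ≤ 1 + 2 * ((8 / (1 - ‖w‖ ^ 2)) / ‖z0 - z‖) ^ 3 := by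
        refine (norm_sub_le _ _).trans ?_
        rw [norm_one, norm_mul, norm_pow, Complex.norm_ofNat]
        gcongr
    _ ≤ 8 / ‖z0 - z‖ ^ 3 + 2 * ((8 / (1 - ‖w‖ ^ 2)) / ‖z0 - z‖) ^ 3 := by
        gcongr
        rw [le_div_iff₀ (by positivity), one_mul]
        calc ‖z0 - z‖ ^ 3 ≤ 2 ^ 3 := by gcongr
          _ = 8 := by norm_num
    _ = _ := by rw [div_pow, add_div, mul_div_assoc]

lemma rep {ω : ℂ → ℝ} {k : ℂ → ℂ} {w : ℂ} (hω : ContinuousOn ω closedDisk) (hr : Reproduces ω k w)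
    {f : ℂ → ℂ} (hf : ContinuousOn f closedDisk) (hd : DifferentiableOn ℂ f unitDisk) :
    ∫ z in unitDisk, f z * starRingEnd ℂ (k z) * (ω z : ℂ) = Real.pi * f w := by
  have hi : IntegrableOn (fun z => ‖f z‖ ^ 2 * ω z) unitDisk := by
    have : IntegrableOn (fun z => ‖f z‖ ^ 2 * ω z) closedDisk :=
      ContinuousOn.integrableOn_compact (isCompact_closedBall _ _) ((hf.norm.pow 2).mul hω)
    exact this.mono_set ball_subset_closedBall
  have h := hr.2 f ⟨hd, by
    unfold dSigma IntegrableOn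
    rw [Measure.restrict_smul]
    exact hi.smul_measure ENNReal.ofReal_ne_top⟩
  unfold dSigma at h
  rw [Measure.restrict_smul, integral_smul_measure, ENNReal.toReal_ofReal (by positivity)] at h
  rw [← h, Complex.real_smul]
  push_cast
  have := Real.pi_ne_zero
  field_simp

lemma stepUpper {w z0 : ℂ} (hw : ‖w‖ < 1) (h0 : ‖z0‖ = 1) {ω : ℂ → ℝ} {k : ℂ → ℂ}
    (hωpos : ∀ z ∈ closedDisk, 0 < ω z)
    (hω : ContinuousOn ω closedDisk)
    (hk : DifferentiableOn ℂ k unitDisk) (hkc : ContinuousOn k closedDisk)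
    (hr : Reproduces ω k w)
    {C M : ℝ} (hC0 : 0 ≤ C) (hC : ∀ z, ‖z‖ ≤ 1 → ‖k z‖ ≤ C * ‖z0 - z‖)
    (hM : ∀ z, ‖z‖ ≤ 1 → ω z ≤ M) :
    ∫ z in unitDisk, ‖k z‖ ^ 2 * ω z * (1 - 2 * XX w z0 z ^ 3).re < 0 := by
  have hmem' : ∀ z : ℂ, ‖z‖ < 1 → z ∈ closedDisk := fun z hz => by simpa [closedDisk] using hz.le
  have hM0 : 0 ≤ M := (hωpos 0 (hmem' 0 (by simp))).le.trans (hM 0 (by simp))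
  set h : ℂ → ℝ := fun z => ‖k z‖ ^ 2 * ω z with hdef
  have hcont : ContinuousOn h closedDisk := (hkc.norm.pow 2).mul hω
  have hint : IntegrableOn h unitDisk :=
    (ContinuousOn.integrableOn_compact (isCompact_closedBall _ _) hcont).mono_set
      ball_subset_closedBall
  have hnn : ∀ z ∈ unitDisk, 0 ≤ h z := by
    intro z hz
    have := hωpos z (ball_subset_closedBall hz)
    simp only [hdef]; positivity
  have hrep : ∀ g : ℂ → ℂ, ContinuousOn g closedDisk → DifferentiableOn ℂ g unitDisk →
      ∫ z in unitDisk, (h z : ℂ) * g z = Real.pi * (k w * g w) := by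
    intro g hg hgd
    rw [← rep (f := fun z => k z * g z) hω hr (hkc.mul hg) (hk.mul hgd)]
    congr 1; ext z
    simp only [hdef]; push_cast
    rw [← Complex.mul_conj']; ring
  have hI : ((∫ z in unitDisk, h z : ℝ) : ℂ) = Real.pi * k w := by
    have := hrep (fun _ => 1) continuousOn_const (differentiableOn_const _)
    simp only [mul_one] at this
    rw [← this]; exact integral_ofReal.symm
  have hIpos : 0 < ∫ z in unitDisk, h z := by
    refine lt_of_le_of_ne (setIntegral_nonneg measurableSet_ball hnn) fun he => ?_
    have hae := (setIntegral_eq_zero_iff_of_nonneg_ae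
      ((ae_restrict_iff' measurableSet_ball).2 (Filter.Eventually.of_forall hnn)) hint).1 he.symm
    have h1 := rep (f := fun _ => 1) hω hr continuousOn_const (differentiableOn_const _)
    have h2 : ∫ z in unitDisk, (1 : ℂ) * starRingEnd ℂ (k z) * (ω z : ℂ) = 0 := by
      rw [← integral_zero ℂ ℂ (μ := volume.restrict unitDisk)]
      apply integral_congr_ae
      filter_upwards [hae, ae_restrict_mem measurableSet_ball] with z hz hzm
      have hp := hωpos z (ball_subset_closedBall hzm)
      have : k z = 0 := by
        simpa [hdef, hp.ne'] using hz
      simp [this]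
    rw [h2] at h1
    have := Real.pi_ne_zero
    simp at h1
    exact this (by exact_mod_cast h1.symm)
  set r : ℕ → ℝ := fun n => 1 - 1 / ((n : ℝ) + 2) with hr
  have hr0 : ∀ n, 0 < r n := by
    intro n
    have : 1 / ((n : ℝ) + 2) < 1 := by rw [div_lt_one (by positivity)]; linarith [Nat.cast_nonneg (α := ℝ) n]
    simp only [hr]; linarith
  have hr1 : ∀ n, r n < 1 := by
    intro n
    have : 0 < 1 / ((n : ℝ) + 2) := by positivity
    simp only [hr]; linarith
  have hrt : Filter.Tendsto r Filter.atTop (nhds 1) := by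
    have h := (tendsto_one_div_add_atTop_nhds_zero_nat (𝕜 := ℝ)).comp (Filter.tendsto_add_atTop_nat 1)
    have h2 := h.const_sub 1
    rw [sub_zero] at h2
    refine h2.congr fun n => ?_
    simp only [hr, Function.comp]; push_cast; ring_nf
  have hden : ∀ n, ∀ z : ℂ, ‖z‖ ≤ 1 → (1 - w * starRingEnd ℂ w) * (z0 - (r n : ℂ) * z) ≠ 0 := by
    intro n z hz
    apply mul_ne_zero (c_ne hw) (b_ne h0 _)
    rw [norm_mul, Complex.norm_real, Real.norm_of_nonneg (hr0 n).le]
    have := hr1 n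
    have := hr0 n
    nlinarith [norm_nonneg z]
  have hgc : ∀ n, ContinuousOn (fun z => 1 - 2 * XR w z0 (r n) z ^ 3) closedDisk := by
    intro n
    unfold XR
    refine continuousOn_const.sub (continuousOn_const.mul (ContinuousOn.pow (ContinuousOn.div ?_ ?_ ?_) 3))
    · fun_prop
    · fun_prop
    · intro z hz
      exact hden n z (by simpa [closedDisk] using hz)
  have hgd : ∀ n, DifferentiableOn ℂ (fun z => 1 - 2 * XR w z0 (r n) z ^ 3) unitDisk := by
    intro n
    unfold XR
    refine (differentiableOn_const _).sub ((differentiableOn_const _).mul (DifferentiableOn.pow (DifferentiableOn.div ?_ ?_ ?_) 3))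
    · fun_prop
    · fun_prop
    · intro z hz
      exact hden n z (by simpa using (mem_ball_zero_iff.1 hz).le)
  have hXt : ∀ z : ℂ, ‖z‖ < 1 → Filter.Tendsto (fun n => 1 - 2 * XR w z0 (r n) z ^ 3) Filter.atTop
      (nhds (1 - 2 * XX w z0 z ^ 3)) := by
    intro z hz
    have hrc : Filter.Tendsto (fun n => (r n : ℂ)) Filter.atTop (nhds ((1 : ℝ) : ℂ)) :=
      (Complex.continuous_ofReal.tendsto 1).comp hrt
    rw [← XR_one]
    unfold XR
    refine ((Filter.Tendsto.div tendsto_const_nhds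
      (((hrc.mul_const z).const_sub z0).const_mul _) ?_).pow 3 |>.const_mul 2).const_sub 1
    rw [Complex.ofReal_one, one_mul]
    exact mul_ne_zero (c_ne hw) (b_ne h0 hz)
  set E : ℝ := 8 + 2 * (8 / (1 - ‖w‖ ^ 2)) ^ 3
  have hc0 : 0 < 1 - ‖w‖ ^ 2 := by nlinarith [norm_nonneg w]
  have hbd : ∀ (z : ℂ) (ρ : ℝ), ‖z‖ < 1 → 0 ≤ ρ → ρ ≤ 1 →
      ‖(h z : ℂ) * (1 - 2 * XR w z0 ρ z ^ 3)‖ ≤ (C ^ 2 * M * E) / ‖z0 - z‖ := by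
    intro z ρ hz hρ0 hρ1
    have ht : 0 < ‖z0 - z‖ := norm_pos_iff.2 (b_ne h0 hz)
    have hg := g_bound hw h0 hz hρ0 hρ1
    have hω0 := hωpos z (hmem' z hz)
    have hh : ‖(h z : ℂ)‖ ≤ (C * ‖z0 - z‖) ^ 2 * M := by
      rw [Complex.norm_real, Real.norm_of_nonneg (hnn z (by simpa [unitDisk] using hz))]
      have := hC z hz.le
      have := hM z hz.le
      simp only [hdef]
      gcongr
    rw [norm_mul]
    calc _ ≤ ((C * ‖z0 - z‖) ^ 2 * M) * (E / ‖z0 - z‖ ^ 3) := by gcongr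
      _ = _ := by field_simp
  have hmeas : ∀ n, AEStronglyMeasurable (fun z => (h z : ℂ) * (1 - 2 * XR w z0 (r n) z ^ 3))
      (volume.restrict unitDisk) := by
    intro n
    apply ContinuousOn.aestronglyMeasurable _ measurableSet_ball
    exact (((Complex.continuous_ofReal.comp_continuousOn hcont).mul (hgc n))).mono ball_subset_closedBall
  have hlim : ∀ᵐ z ∂(volume.restrict unitDisk), Filter.Tendsto
      (fun n => (h z : ℂ) * (1 - 2 * XR w z0 (r n) z ^ 3)) Filter.atTop
      (nhds ((h z : ℂ) * (1 - 2 * XX w z0 z ^ 3))) := by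
    filter_upwards [ae_restrict_mem measurableSet_ball] with z hz
    exact (hXt z (mem_ball_zero_iff.1 hz)).const_mul _
  have key := tendsto_integral_of_dominated_convergence (μ := volume.restrict unitDisk)
    (F := fun n z => (h z : ℂ) * (1 - 2 * XR w z0 (r n) z ^ 3))
    (f := fun z => (h z : ℂ) * (1 - 2 * XX w z0 z ^ 3))
    (fun z => (C ^ 2 * M * E) / ‖z0 - z‖) hmeas (int_inv z0 _)
    (fun n => by
      filter_upwards [ae_restrict_mem measurableSet_ball] with z hz
      exact hbd z _ (mem_ball_zero_iff.1 hz) (hr0 n).le (hr1 n).le) hlim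
  have key2 : Filter.Tendsto (fun n => ∫ z in unitDisk, (h z : ℂ) * (1 - 2 * XR w z0 (r n) z ^ 3))
      Filter.atTop (nhds (Real.pi * (k w * (1 - 2 * XX w z0 w ^ 3)))) := by
    refine Filter.Tendsto.congr (fun n => (hrep _ (hgc n) (hgd n)).symm) ?_
    exact ((hXt w hw).const_mul _).const_mul _
  have heq := tendsto_nhds_unique key key2
  have hfi : IntegrableOn (fun z => (h z : ℂ) * (1 - 2 * XX w z0 z ^ 3)) unitDisk := by
    refine Integrable.mono' (int_inv z0 (C ^ 2 * M * E))
      (aestronglyMeasurable_of_tendsto_ae _ hmeas hlim) ?_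
    filter_upwards [ae_restrict_mem measurableSet_ball] with z hz
    have := hbd z 1 (mem_ball_zero_iff.1 hz) zero_le_one le_rfl
    rwa [XR_one] at this
  have hre : ∫ z in unitDisk, h z * (1 - 2 * XX w z0 z ^ 3).re =
      (∫ z in unitDisk, (h z : ℂ) * (1 - 2 * XX w z0 z ^ 3)).re := by
    have := Complex.reCLM.integral_comp_comm hfi
    simp only [Complex.reCLM_apply, Complex.re_ofReal_mul] at this
    exact this
  rw [hre, heq, XX_w hw h0, ← mul_assoc, ← hI]
  norm_num
  exact hIpos

end helpers6

/-- With ω as before and K(·,w) holomorphic on 𝔻, C¹ on the closed disk,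
and reproducing at w for ω, the kernel K has no zeros on 𝕋 × 𝔻. -/
theorem statement1 (ω : ℂ → ℝ) (K : ℂ → ℂ → ℂ)
    (hωpos : ∀ z ∈ closedDisk, 0 < ω z)
    (hωsmooth : ContDiffOn ℝ (⊤ : ℕ∞) ω closedDisk)
    (hsub : ∀ z ∈ unitDisk, 0 ≤ lapR (fun z => Real.log (ω z / (1 - ‖z‖ ^ 2))) z)
    (hK : ∀ w ∈ unitDisk,
      DifferentiableOn ℂ (fun z => K z w) unitDisk ∧
      ContDiffOn ℝ 1 (fun z => K z w) closedDisk ∧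
      Reproduces ω (fun z => K z w) w) :
    ∀ z ∈ unitCircle, ∀ w ∈ unitDisk, K z w ≠ 0 := by
  intro z0 hz0 w hwm hzero
  obtain ⟨hd, hc1, hrep⟩ := hK w hwm
  have h0 : ‖z0‖ = 1 := mem_sphere_zero_iff_norm.1 hz0
  have hw : ‖w‖ < 1 := mem_ball_zero_iff.1 hwm
  obtain ⟨C, hC0, hC⟩ := lip hc1 h0 hzero
  obtain ⟨M, hM⟩ := (isCompact_closedBall (0 : ℂ) 1).exists_bound_of_continuousOn
    hωsmooth.continuousOn
  have hM' : ∀ z, ‖z‖ ≤ 1 → ω z ≤ M := fun z hz =>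
    (le_abs_self _).trans (hM z (by simpa using hz))
  have h1 := stepLower hw h0 hωpos hωsmooth hsub hd hC0 hC hM'
  have h2 := stepUpper hw h0 hωpos hωsmooth.continuousOn hd hc1.continuousOn hrep hC0 hC hM'
  linarith

end
end
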